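/- arXiv:1901.07166 — 10 statements merged into one kernel-verified Lean document; each statement's English description precedes it below -/
import Mathlib

section
/- Let R be a commutative local ring in which 2 is invertible, let G be a group, and let T : G → R be a 2-dimensional pseudo-representation. Suppose σ* ∈ G satisfies (σ*)² = 1 and T(σ*) lies in the maximal ideal of R. Then T(σ*) = 0. -/
/-- Let `R` be a commutative local ring in which `2` is invertible, `G` a group,
and `T : G → R` a 2-dimensional pseudo-representation.  If `σs ∈ G` satisfies `σs ^ 2 = 1` and
`T σs` lies in the maximal ideal of `R`, then `T σs = 0`. -/
theorem pseudoRep_eval_order_two_mem_maximalIdeal_eq_zero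
    {R : Type*} [CommRing R] [IsLocalRing R] {G : Type*} [Group G]
    (T : G → R) (h2 : IsUnit (2 : R))
    (hT1 : T 1 = 2)
    (hTcomm : ∀ σ τ : G, T (σ * τ) = T (τ * σ))
    (hTrel : ∀ γ δ η : G,
      T (γ * δ * η) + T (γ * η * δ) - T (γ * η) * T δ - T (η * δ) * T γ -
        T (δ * γ) * T η + T γ * T δ * T η = 0)
    (σs : G) (hσs : σs ^ 2 = 1) (hmem : T σs ∈ IsLocalRing.maximalIdeal R) :
    T σs = 0 := by
  have hs : σs * σs = 1 := by rw [← pow_two, hσs]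
  have hcubic : T σs * (T σs ^ 2 - 2 * 2) = 0 := by
    have h := hTrel σs σs σs
    rw [hs, one_mul, hT1] at h
    linear_combination h
  have hunit : IsUnit (T σs ^ 2 - 2 * 2) := by
    by_contra hn
    have hsub := Ideal.sub_mem _ (Ideal.pow_mem_of_mem _ hmem 2 two_pos)
      ((IsLocalRing.mem_maximalIdeal _).2 hn)
    rw [sub_sub_cancel] at hsub
    exact (IsLocalRing.mem_maximalIdeal _).1 hsub (h2.mul h2)
  exact hunit.mul_left_eq_zero.1 hcubic
end

section
/- Let R be a commutative ring in which 2 is invertible, G a group, T : G → R a 2-dimensional pseudo-representation, and σ* ∈ G an element with (σ*)² = 1 and T(σ*) = 0. Then for all σ, τ ∈ G one has x(σ,τ) = d(τσ) − d(τ)d(σ). -/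
section PseudoRep

variable {R : Type*} [CommRing R] {G : Type*} [Group G]

/-- `a(σ) = (1/2)(T(σ*σ) + T(σ))`. -/
noncomputable def aPR (T : G → R) (σs σ : G) : R :=
  Ring.inverse 2 * (T (σs * σ) + T σ)

/-- `d(σ) = (1/2)(−T(σ*σ) + T(σ)) = T(σ) − a(σ)`. -/
noncomputable def dPR (T : G → R) (σs σ : G) : R :=
  T σ - aPR T σs σ

/-- `x(σ,τ) = a(στ) − a(σ)a(τ)`. -/
noncomputable def xPR (T : G → R) (σs σ τ : G) : R :=
  aPR T σs (σ * τ) - aPR T σs σ * aPR T σs τ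

theorem dPR_eq_inverse_two_mul (T : G → R) (h2 : IsUnit (2 : R)) (σs σ : G) :
    dPR T σs σ = Ring.inverse 2 * (T σ - T (σs * σ)) := by
  have hinv : (2 : R) * Ring.inverse 2 = 1 := Ring.mul_inverse_cancel 2 h2
  simp only [dPR, aPR]
  linear_combination (-T σ) * hinv

/-- For a 2-dimensional pseudo-representation `T` over a commutative ring in
which `2` is invertible, together with `σs` of order dividing 2 with `T σs = 0`, one has
`x(σ,τ) = d(τσ) − d(τ)d(σ)` for all `σ τ`. -/
theorem xPR_eq_dPR_mul (T : G → R) (h2 : IsUnit (2 : R))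
    (hT1 : T 1 = 2)
    (hTcomm : ∀ σ τ : G, T (σ * τ) = T (τ * σ))
    (hTrel : ∀ γ δ η : G,
      T (γ * δ * η) + T (γ * η * δ) - T (γ * η) * T δ - T (η * δ) * T γ -
        T (δ * γ) * T η + T γ * T δ * T η = 0)
    (σs : G) (hσs : σs ^ 2 = 1) (hTσs : T σs = 0)
    (σ τ : G) :
    xPR T σs σ τ = dPR T σs (τ * σ) - dPR T σs τ * dPR T σs σ := by
  have hinv : (2 : R) * Ring.inverse 2 = 1 := Ring.mul_inverse_cancel 2 h2
  have hrel := hTrel σs σ τ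
  rw [hTσs, hTcomm σ σs] at hrel
  simp only [dPR_eq_inverse_two_mul T h2, xPR, aPR]
  rw [hTcomm τ σ, ← mul_assoc σs σ τ, ← mul_assoc σs τ σ]
  linear_combination Ring.inverse 2 * hrel -
    Ring.inverse 2 * (T (σs * σ) * T τ + T σ * T (σs * τ)) * hinv

end PseudoRep
end

section
/- Let R be a commutative ring in which 2 is invertible, G a group, T : G → R a 2-dimensional pseudo-representation, and σ* ∈ G an element with (σ*)² = 1 and T(σ*) = 0. Then for all σ, τ, δ ∈ G one has x(στ,δ) = a(σ)x(τ,δ) + x(σ,δ)d(τ) and x(σ,τδ) = a(δ)x(σ,τ) + x(σ,δ)d(τ). -/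
section PseudoRep

variable {R : Type*} [CommRing R] {G : Type*} [Group G]

theorem two_mul_aPR (h2 : IsUnit (2 : R)) (T : G → R) (σs σ : G) :
    2 * aPR T σs σ = T (σs * σ) + T σ :=
  Ring.mul_inverse_cancel_left 2 _ h2

theorem two_mul_dPR (h2 : IsUnit (2 : R)) (T : G → R) (σs σ : G) :
    2 * dPR T σs σ = T σ - T (σs * σ) := by
  unfold dPR
  linear_combination -two_mul_aPR h2 T σs σ

/-- For a 2-dimensional pseudo-representation `T` over a commutative ring in
which `2` is invertible, together with `σs` of order dividing 2 with `T σs = 0`, one has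
`x(στ,δ) = a(σ)x(τ,δ) + x(σ,δ)d(τ)` and `x(σ,τδ) = a(δ)x(σ,τ) + x(σ,δ)d(τ)`. -/
theorem xPR_mul_left_right (T : G → R) (h2 : IsUnit (2 : R))
    (hT1 : T 1 = 2)
    (hTcomm : ∀ σ τ : G, T (σ * τ) = T (τ * σ))
    (hTrel : ∀ γ δ η : G,
      T (γ * δ * η) + T (γ * η * δ) - T (γ * η) * T δ - T (η * δ) * T γ -
        T (δ * γ) * T η + T γ * T δ * T η = 0)
    (σs : G) (hσs : σs ^ 2 = 1) (hTσs : T σs = 0) :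
    (∀ σ τ δ : G,
      xPR T σs (σ * τ) δ = aPR T σs σ * xPR T σs τ δ + xPR T σs σ δ * dPR T σs τ) ∧
    (∀ σ τ δ : G,
      xPR T σs σ (τ * δ) = aPR T σs δ * xPR T σs σ τ + xPR T σs σ δ * dPR T σs τ) := by
  have hss : ∀ x : G, σs * (σs * x) = x := fun x => by
    rw [← mul_assoc, ← pow_two, hσs, one_mul]
  have hcyc : ∀ x y z : G, T (x * (y * z)) = T (z * (x * y)) := fun x y z => by
    rw [← mul_assoc, hTcomm]
  have hadd : ∀ x y : G,
      T (σs * (x * y)) + T (x * (σs * y)) = T x * T (σs * y) + T (σs * x) * T y := fun x y => by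
    have h := hTrel σs x y
    rw [hTσs, hTcomm x σs, mul_assoc, mul_assoc, hcyc σs y x] at h
    linear_combination h
  have hmul : ∀ x y : G,
      T (x * y) + T (σs * (x * (σs * y))) = T x * T y + T (σs * x) * T (σs * y) := fun x y => by
    have h := hadd (σs * x) y
    simp only [mul_assoc, hss] at h
    linear_combination h
  -- `T (e * x * e * y) = T (e * x) * T (e * y)` for the idempotent `e = (1 + σs) / 2`
  have hplus : ∀ x y : G,
      T (x * y) + T (σs * (x * y)) + T (x * (σs * y)) + T (σs * (x * (σs * y))) =
        2 * aPR T σs x * (T y + T (σs * y)) := fun x y => by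
    rw [two_mul_aPR h2]
    linear_combination hadd x y + hmul x y
  -- the same identity for the complementary idempotent `(1 - σs) / 2`
  have hminus : ∀ x y : G,
      T (x * y) - T (σs * (x * y)) - T (x * (σs * y)) + T (σs * (x * (σs * y))) =
        (T x - T (σs * x)) * (2 * dPR T σs y) := fun x y => by
    rw [two_mul_dPR h2]
    linear_combination hmul x y - hadd x y
  have hx : ∀ x y : G, 4 * xPR T σs x y =
      T (x * y) + T (σs * (x * y)) - T (x * (σs * y)) - T (σs * (x * (σs * y))) := fun x y => by
    have h := hplus x y
    unfold xPR
    linear_combination 2 * two_mul_aPR h2 T σs (x * y) + h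
      - 2 * aPR T σs x * two_mul_aPR h2 T σs y
  have h8 : IsUnit (8 : R) := by
    have h := h2.pow 3
    norm_num at h
    exact h
  have hd : ∀ σ τ δ : G,
      T (σ * (τ * δ)) - T (σ * (τ * (σs * δ))) - T (σ * (σs * (τ * δ)))
        + T (σ * (σs * (τ * (σs * δ)))) =
        (T (σ * δ) - T (σ * (σs * δ))) * (2 * dPR T σs τ) := fun σ τ δ => by
    have h := hminus (δ * σ) τ
    have e₁ : T (σ * (τ * δ)) = T (δ * σ * τ) := by rw [hcyc, mul_assoc]
    have e₂ : T (σ * (τ * (σs * δ))) = T (σs * (δ * σ * τ)) := by rw [hcyc]; simp only [mul_assoc]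
    have e₃ : T (σ * (σs * (τ * δ))) = T (δ * σ * (σs * τ)) := by
      rw [← mul_assoc σs, hcyc, mul_assoc]
    have e₄ : T (σ * (σs * (τ * (σs * δ)))) = T (σs * (δ * σ * (σs * τ))) := by
      rw [← mul_assoc σs τ, hcyc]; simp only [mul_assoc]
    have e₅ : T (σ * (σs * δ)) = T (σs * (δ * σ)) := by rw [hTcomm, mul_assoc]
    rw [e₁, e₂, e₃, e₄, e₅, hTcomm σ δ]
    exact h
  have hxd : ∀ σ τ δ : G,
      T (σ * (τ * δ)) - T (σ * (τ * (σs * δ))) - T (σ * (σs * (τ * δ)))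
        + T (σ * (σs * (τ * (σs * δ)))) + T (σs * (σ * (τ * δ)))
        - T (σs * (σ * (τ * (σs * δ)))) - T (σs * (σ * (σs * (τ * δ))))
        + T (σs * (σ * (σs * (τ * (σs * δ))))) =
        8 * (xPR T σs σ δ * dPR T σs τ) := fun σ τ δ => by
    have h := hd (σs * σ) τ δ
    simp only [mul_assoc] at h
    linear_combination hd σ τ δ + h - 2 * dPR T σs τ * hx σ δ
  refine ⟨fun σ τ δ => h8.mul_left_cancel ?_, fun σ τ δ => h8.mul_left_cancel ?_⟩
  · have h := hx (σ * τ) δ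
    simp only [mul_assoc] at h
    linear_combination 2 * h + hplus σ (τ * δ) - hplus σ (τ * (σs * δ)) + hxd σ τ δ
      - 2 * aPR T σs σ * hx τ δ
  · have h₁ := hplus δ (σ * τ)
    have h₂ := hplus δ (σ * (σs * τ))
    have r : ∀ x y : G, T (δ * (x * y)) = T (x * (y * δ)) := fun x y => (hcyc x y δ).symm
    have r' : ∀ x y : G, T (σs * (δ * (x * y))) = T (x * (y * (σs * δ))) := fun x y => by
      rw [hcyc x y, mul_assoc]
    simp only [r, r', mul_assoc] at h₁ h₂
    linear_combination 2 * hx σ (τ * δ) + h₁ - h₂ + hxd σ τ δ - 2 * aPR T σs δ * hx σ τ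

end PseudoRep
end

section
/- Let R be a commutative ring in which 2 is invertible, G a group, T : G → R a 2-dimensional pseudo-representation, and σ* ∈ G an element with (σ*)² = 1 and T(σ*) = 0. Then for all α, β, σ, τ ∈ G one has x(α,β)x(σ,τ) = x(α,τ)x(σ,β). -/
section PseudoRep

variable {R : Type*} [CommRing R] {G : Type*} [Group G]

/-- A two-dimensional trace identity on an algebra makes the trace multiplicative on every corner
`e A e` cut out by an idempotent of trace one. -/
theorem trace_mul_of_corner {A : Type*} [Ring A] [Algebra R A] (t : A →ₗ[R] R)
    (hcomm : ∀ x y : A, t (x * y) = t (y * x))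
    (hrel : ∀ x y z : A,
      t (x * y * z) + t (x * z * y) - t (x * z) * t y - t (z * y) * t x -
        t (y * x) * t z + t x * t y * t z = 0)
    {e u v : A} (he : t e = 1) (hu : e * u = u) (hu' : u * e = u) (hv : e * v = v) :
    t (u * v) = t u * t v := by
  have h := hrel e u v
  rw [hu, hv, hu', he, hcomm v u] at h
  linear_combination h

/-- The exchange relation for the products `e x f y`, for idempotents `e` and `f` of trace one. -/
theorem trace_offDiag_mul {A : Type*} [Ring A] [Algebra R A] (t : A →ₗ[R] R)
    (hcomm : ∀ x y : A, t (x * y) = t (y * x))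
    (hrel : ∀ x y z : A,
      t (x * y * z) + t (x * z * y) - t (x * z) * t y - t (z * y) * t x -
        t (y * x) * t z + t x * t y * t z = 0)
    {e f : A} (hee : e * e = e) (hff : f * f = f) (he : t e = 1) (hf : t f = 1) (x y z w : A) :
    t (e * x * f * y) * t (e * z * f * w) = t (e * x * f * w) * t (e * z * f * y) := by
  have hl : ∀ {p : A}, p * p = p → ∀ q : A, p * (p * q) = p * q := fun h q => by
    rw [← mul_assoc, h]
  have key : ∀ {p q : A}, p * p = p → t p = 1 → ∀ a b c d : A,
      t (p * a * q * b * p * c * q * d) = t (p * a * q * b) * t (p * c * q * d) := by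
    intro p q hp htp a b c d
    have h := trace_mul_of_corner t hcomm hrel (e := p) (u := p * a * q * b * p)
      (v := p * c * q * d * p) htp (by simp only [mul_assoc, hl hp])
      (by simp only [mul_assoc, hp]) (by simp only [mul_assoc, hl hp])
    have hcut : ∀ r : A, t (p * r * p) = t (p * r) := fun r => by
      rw [hcomm, ← mul_assoc, hp]
    have h₁ := hcut (a * q * b)
    have h₂ := hcut (c * q * d)
    have h₃ := hcut (a * q * b * p * c * q * d)
    simp only [mul_assoc, hl hp] at h h₁ h₂ h₃ ⊢
    rw [← h₃, h, h₁, h₂]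
  have h₁ := key (q := f) hee he x y z w
  have h₂ := key (q := e) hff hf y z w x
  have h₃ := hcomm (e * x) (f * y * e * z * f * w)
  have h₄ := hcomm (f * y) (e * z)
  have h₅ := hcomm (f * w) (e * x)
  simp only [mul_assoc] at h₁ h₂ h₃ h₄ h₅ ⊢
  rw [← h₁, h₃, h₂, h₄, h₅, mul_comm]

/-- The linear extension to the group algebra of a function on a group. -/
noncomputable def groupAlgebraExtend (T : G → R) :
    MonoidAlgebra R G →ₗ[R] R :=
  Finsupp.linearCombination R T ∘ₗ (MonoidAlgebra.coeffLinearEquiv R).toLinearMap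

theorem groupAlgebraExtend_of (T : G → R) (g : G) :
    groupAlgebraExtend T (MonoidAlgebra.of R G g) = T g := by
  simp [groupAlgebraExtend]

theorem groupAlgebraExtend_mul_comm {T : G → R}
    (hT : ∀ σ τ : G, T (σ * τ) = T (τ * σ)) (x y : MonoidAlgebra R G) :
    groupAlgebraExtend T (x * y) = groupAlgebraExtend T (y * x) := by
  induction x using MonoidAlgebra.induction_on with
  | of g =>
    induction y using MonoidAlgebra.induction_on with
    | of h => simp only [← map_mul, groupAlgebraExtend_of, hT g h]
    | add a b ha hb => simp only [mul_add, add_mul, map_add, ha, hb]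
    | smul r a ha => simp only [mul_smul_comm, smul_mul_assoc, map_smul, ha]
  | add a b ha hb => simp only [mul_add, add_mul, map_add, ha, hb]
  | smul r a ha => simp only [mul_smul_comm, smul_mul_assoc, map_smul, ha]

theorem groupAlgebraExtend_trace_relation {T : G → R}
    (hT : ∀ γ δ η : G,
      T (γ * δ * η) + T (γ * η * δ) - T (γ * η) * T δ - T (η * δ) * T γ -
        T (δ * γ) * T η + T γ * T δ * T η = 0) (x y z : MonoidAlgebra R G) :
    groupAlgebraExtend T (x * y * z) + groupAlgebraExtend T (x * z * y) -
      groupAlgebraExtend T (x * z) * groupAlgebraExtend T y -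
      groupAlgebraExtend T (z * y) * groupAlgebraExtend T x -
      groupAlgebraExtend T (y * x) * groupAlgebraExtend T z +
      groupAlgebraExtend T x * groupAlgebraExtend T y * groupAlgebraExtend T z = 0 := by
  induction x using MonoidAlgebra.induction_on with
  | of g =>
    induction y using MonoidAlgebra.induction_on with
    | of h =>
      induction z using MonoidAlgebra.induction_on with
      | of k => simpa only [← map_mul, groupAlgebraExtend_of] using hT g h k
      | add a b ha hb =>
        simp only [mul_add, add_mul, map_add]
        linear_combination ha + hb
      | smul r a ha =>
        simp only [mul_smul_comm, smul_mul_assoc, map_smul, smul_eq_mul]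
        linear_combination r * ha
    | add a b ha hb =>
      simp only [mul_add, add_mul, map_add]
      linear_combination ha + hb
    | smul r a ha =>
      simp only [mul_smul_comm, smul_mul_assoc, map_smul, smul_eq_mul]
      linear_combination r * ha
  | add a b ha hb =>
    simp only [mul_add, add_mul, map_add]
    linear_combination ha + hb
  | smul r a ha =>
    simp only [mul_smul_comm, smul_mul_assoc, map_smul, smul_eq_mul]
    linear_combination r * ha

/-- For a 2-dimensional pseudo-representation `T` over a commutative ring in
which `2` is invertible, together with `σs` of order dividing 2 with `T σs = 0`, one has
`x(α,β)x(σ,τ) = x(α,τ)x(σ,β)` for all `α β σ τ`. -/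
theorem xPR_mul_xPR (T : G → R) (h2 : IsUnit (2 : R))
    (hT1 : T 1 = 2)
    (hTcomm : ∀ σ τ : G, T (σ * τ) = T (τ * σ))
    (hTrel : ∀ γ δ η : G,
      T (γ * δ * η) + T (γ * η * δ) - T (γ * η) * T δ - T (η * δ) * T γ -
        T (δ * γ) * T η + T γ * T δ * T η = 0)
    (σs : G) (hσs : σs ^ 2 = 1) (hTσs : T σs = 0)
    (α β σ τ : G) :
    xPR T σs α β * xPR T σs σ τ = xPR T σs α τ * xPR T σs σ β := by
  have hcomm := groupAlgebraExtend_mul_comm hTcomm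
  have hrel := groupAlgebraExtend_trace_relation hTrel
  have hof := groupAlgebraExtend_of T
  set t := groupAlgebraExtend T
  let ι := MonoidAlgebra.of R G
  set c : R := Ring.inverse 2
  have hc : c * 2 = 1 := Ring.inverse_mul_cancel 2 h2
  set e : MonoidAlgebra R G := c • (ι σs + 1) with e_def
  have hs : ι σs * ι σs = 1 := by rw [← map_mul, ← sq, hσs, map_one]
  have hee : e * e = e := by
    have h : (ι σs + 1) * (ι σs + 1) = (2 : R) • (ι σs + 1) := by
      rw [two_smul, mul_add, add_mul, hs, mul_one, one_mul]
      abel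
    rw [e_def, smul_mul_smul_comm, h, smul_smul, mul_assoc, hc, mul_one]
  have hff : (1 - e) * (1 - e) = 1 - e := by
    simp [mul_sub, sub_mul, hee]
  have ht1 : t 1 = 2 := by rw [← map_one ι, hof, hT1]
  have he : t e = 1 := by
    rw [e_def, map_smul, map_add, hof, ht1, hTσs, zero_add, smul_eq_mul, hc]
  have hf : t (1 - e) = 1 := by
    rw [map_sub, ht1, he]
    norm_num
  have ha : ∀ g : G, aPR T σs g = t (e * ι g) := fun g => by
    rw [e_def, smul_mul_assoc, add_mul, one_mul, ← map_mul, map_smul, map_add, hof, hof]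
    rfl
  have hx : ∀ g h : G, xPR T σs g h = t (e * ι g * (1 - e) * ι h) := fun g h => by
    have hcut : ∀ r : MonoidAlgebra R G, t (e * r * e) = t (e * r) := fun r => by
      rw [hcomm, ← mul_assoc, hee]
    have hmul := trace_mul_of_corner t hcomm hrel (e := e) (u := e * ι g * e)
      (v := e * ι h * e) he (by simp only [← mul_assoc, hee])
      (by simp only [mul_assoc, hee]) (by simp only [← mul_assoc, hee])
    have hprod : e * ι g * e * (e * ι h * e) = e * (ι g * e * ι h) * e := by
      rw [show e * ι g * e * (e * ι h * e) = e * ι g * (e * e) * ι h * e by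
        simp only [mul_assoc], hee]
      simp only [mul_assoc]
    rw [hprod, hcut, hcut, hcut] at hmul
    rw [xPR, ha, ha, ha, ← hmul, mul_sub, mul_one, sub_mul, map_sub, map_mul ι]
    simp only [mul_assoc]
  simp only [hx]
  exact trace_offDiag_mul t hcomm hrel hee hff he hf _ _ _ _

end PseudoRep
end

section
/- Let R be a commutative ring in which 2 is invertible, G a group, and ρ : G → GL₂(R) a group homomorphism such that ρ(σ*) is the diagonal matrix diag(1, −1) for some σ* ∈ G (so (σ*)² = 1 and T(σ*) = 0, where T = tr ∘ ρ). Then for all σ, τ ∈ G: a(σ) equals the (1,1)-entry of ρ(σ), d(σ) equals the (2,2)-entry of ρ(σ), and x(σ,τ) equals the (1,2)-entry of ρ(σ) times the (2,1)-entry of ρ(τ). -/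
section PseudoRep

variable {R : Type*} [CommRing R] {G : Type*} [Group G]

/-- If `ρ σs = diag (1, -1)` and `T = tr ∘ ρ`, then `a(σ)` is the `(1,1)` entry of `ρ σ`. -/
theorem aPR_trace_eq (h2 : IsUnit (2 : R))
    (ρ : G →* Matrix.GeneralLinearGroup (Fin 2) R) (σs : G)
    (hσs : (ρ σs : Matrix (Fin 2) (Fin 2) R) = Matrix.diagonal ![1, -1]) (σ : G) :
    aPR (fun g => Matrix.trace ((ρ g : Matrix (Fin 2) (Fin 2) R))) σs σ =
      (ρ σ : Matrix (Fin 2) (Fin 2) R) 0 0 := by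
  have h : Matrix.trace (ρ (σs * σ) : Matrix (Fin 2) (Fin 2) R) +
      Matrix.trace (ρ σ : Matrix (Fin 2) (Fin 2) R) =
        2 * (ρ σ : Matrix (Fin 2) (Fin 2) R) 0 0 := by
    simp only [map_mul, Units.val_mul, hσs, Matrix.trace_fin_two, Matrix.diagonal_mul,
      Matrix.cons_val_zero, Matrix.cons_val_one]
    ring
  rw [aPR, h, Ring.inverse_mul_cancel_left _ _ h2]

/-- Let `ρ : G → GL₂(R)` be a group homomorphism over a commutative ring in which
`2` is invertible, with `ρ σs = diag (1, -1)`.  Then, with `T = tr ∘ ρ`, for all `σ τ` the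
quantity `a(σ)` is the `(1,1)` entry of `ρ σ`, `d(σ)` its `(2,2)` entry, and `x(σ,τ)` is the
product of the `(1,2)` entry of `ρ σ` with the `(2,1)` entry of `ρ τ`. -/
theorem aPR_dPR_xPR_of_rep (h2 : IsUnit (2 : R))
    (ρ : G →* Matrix.GeneralLinearGroup (Fin 2) R) (σs : G)
    (hσs : (ρ σs : Matrix (Fin 2) (Fin 2) R) = Matrix.diagonal ![1, -1]) :
    ∀ σ τ : G,
      aPR (fun g => Matrix.trace ((ρ g : Matrix (Fin 2) (Fin 2) R))) σs σ =
          (ρ σ : Matrix (Fin 2) (Fin 2) R) 0 0 ∧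
      dPR (fun g => Matrix.trace ((ρ g : Matrix (Fin 2) (Fin 2) R))) σs σ =
          (ρ σ : Matrix (Fin 2) (Fin 2) R) 1 1 ∧
      xPR (fun g => Matrix.trace ((ρ g : Matrix (Fin 2) (Fin 2) R))) σs σ τ =
          (ρ σ : Matrix (Fin 2) (Fin 2) R) 0 1 * (ρ τ : Matrix (Fin 2) (Fin 2) R) 1 0 := by
  intro σ τ
  simp only [dPR, xPR, aPR_trace_eq h2 ρ σs hσs]
  simp only [map_mul, Units.val_mul, Matrix.trace_fin_two, Matrix.mul_apply, Fin.sum_univ_two,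
    add_sub_cancel_left, and_self]

end PseudoRep
end

section
/- Let R be a complete Noetherian local commutative ring, I an ideal of R, and {N_i}_{i∈ℕ} a projective system of R-modules such that each N_i is a flat R/Iⁱ-module and the transition maps induce isomorphisms N_i ≅ N_{i+1}/IⁱN_{i+1}. Then N := lim_i N_i is a flat R-module, the natural maps N/IⁱN → N_i are isomorphisms, and for every ideal J of R the natural map N/JN → lim_i (N_i/JN_i) is an isomorphism. -/
section InvLim

variable {A : Type*} [CommRing A]

/-- The inverse limit of a projective system of modules indexed by `ℕ`, realized as the submodule
of compatible sequences in the product. -/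
def InvLimit (M : ℕ → Type*) [∀ n, AddCommGroup (M n)] [∀ n, Module A (M n)]
    (f : ∀ n, M (n + 1) →ₗ[A] M n) : Submodule A (∀ n, M n) where
  carrier := {x | ∀ n, f n (x (n + 1)) = x n}
  add_mem' := by intro a b ha hb n; simp only [Pi.add_apply, map_add, ha n, hb n]
  zero_mem' := by intro n; simp
  smul_mem' := by intro c a ha n; simp only [Pi.smul_apply, map_smul, ha n]

end InvLim

/-- If the target of a linear map is a module over `R ⧸ I`, then `I • ⊤` is contained in its
kernel. -/
lemma smul_top_le_ker {R : Type*} [CommRing R] (I : Ideal R) {A B : Type*}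
    [AddCommGroup A] [Module R A] [AddCommGroup B] [Module R B]
    [Module (R ⧸ I) B] [IsScalarTower R (R ⧸ I) B]
    (g : A →ₗ[R] B) : (I • ⊤ : Submodule R A) ≤ LinearMap.ker g := by
  refine Submodule.smul_le.2 fun r hr x _ => ?_
  have h0 : r • g x = 0 := by
    rw [← algebraMap_smul (R ⧸ I) r (g x), Ideal.Quotient.algebraMap_eq,
      Ideal.Quotient.eq_zero_iff_mem.2 hr, zero_smul]
  simp only [LinearMap.mem_ker, map_smul]
  exact h0

namespace Matrix

variable {R : Type*} [CommRing R] {ι κ τ : Type*} [Fintype ι] [Fintype τ]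
  {M M' : Type*} [AddCommGroup M] [Module R M] [AddCommGroup M'] [Module R M']

/-- A matrix over `R` acting on column vectors with entries in an `R`-module. -/
def smulVecLin (A : Matrix κ ι R) (M : Type*) [AddCommGroup M] [Module R M] :
    (ι → M) →ₗ[R] (κ → M) :=
  LinearMap.pi fun k => ∑ l, A k l • LinearMap.proj l

lemma smulVecLin_apply (A : Matrix κ ι R) (y : ι → M) (k : κ) :
    A.smulVecLin M y k = ∑ l, A k l • y l := by
  simp [smulVecLin]

lemma map_smulVecLin (A : Matrix κ ι R) (g : M →ₗ[R] M') (y : ι → M) (k : κ) :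
    g (A.smulVecLin M y k) = A.smulVecLin M' (fun l => g (y l)) k := by
  simp [smulVecLin_apply]

lemma smulVecLin_mul (A : Matrix κ ι R) (B : Matrix ι τ R) (y : τ → M) :
    (A * B).smulVecLin M y = A.smulVecLin M (B.smulVecLin M y) := by
  ext k
  simp only [smulVecLin_apply, Matrix.mul_apply, Finset.sum_smul, Finset.smul_sum, mul_smul]
  exact Finset.sum_comm

/-- Over a Noetherian ring, the solutions of a homogeneous linear system are generated by the
columns of a finite matrix. -/
lemma exists_relation_matrix [IsNoetherianRing R] (A : Matrix κ ι R) :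
    ∃ (t : ℕ) (B : Matrix ι (Fin t) R), A * B = 0 ∧
      ∀ v : ι → R, A *ᵥ v = 0 → ∃ w, B *ᵥ w = v := by
  obtain ⟨t, b, hb⟩ := Submodule.fg_iff_exists_fin_generating_family.1
    (IsNoetherian.noetherian (LinearMap.ker A.mulVecLin))
  refine ⟨t, Matrix.of fun l j => b j l, ?_, fun v hv => ?_⟩
  · ext k j
    have hj : b j ∈ LinearMap.ker A.mulVecLin := hb ▸ Submodule.subset_span ⟨j, rfl⟩
    have := congrFun (LinearMap.mem_ker.1 hj) k
    simpa [Matrix.mulVec, dotProduct, Matrix.mul_apply] using this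
  · have hv' : v ∈ Submodule.span R (Set.range b) := by
      rw [hb]
      exact hv
    obtain ⟨w, rfl⟩ := (Submodule.mem_span_range_iff_exists_fun R).1 hv'
    refine ⟨w, ?_⟩
    ext l
    simp [Matrix.mulVec, dotProduct, mul_comm]

end Matrix

lemma Ideal.mem_smul_top_pi_iff {R : Type*} [CommRing R] {ι : Type*} [Finite ι] (I : Ideal R)
    (x : ι → R) : x ∈ (I • ⊤ : Submodule R (ι → R)) ↔ ∀ i, x i ∈ I := by
  classical
  have := Fintype.ofFinite ι
  constructor
  · intro hx i
    have h := Submodule.mem_map_of_mem (f := (LinearMap.proj i : (ι → R) →ₗ[R] R)) hx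
    rw [Submodule.map_smul''] at h
    simpa using Submodule.smul_mono (le_refl I) le_top h
  · intro hx
    rw [pi_eq_sum_univ x]
    exact Submodule.sum_mem _ fun i _ => Submodule.smul_mem_smul (hx i) trivial

section Approximation

variable {R : Type*} [CommRing R] {ι κ τ : Type*} [Fintype ι] [Fintype τ]

/-- A form of the Artin–Rees lemma: approximate solutions of a homogeneous linear system are close
to exact solutions. -/
lemma exists_forall_close_to_relation [IsNoetherianRing R] [Finite κ] (I : Ideal R)
    (A : Matrix κ ι R) (B : Matrix ι τ R)
    (hB : ∀ v : ι → R, A.mulVec v = 0 → ∃ w, B.mulVec w = v) :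
    ∃ c, ∀ i, ∀ v : ι → R, (∀ k, A.mulVec v k ∈ I ^ (i + c)) →
      ∃ w, ∀ l, v l - B.mulVec w l ∈ I ^ i := by
  obtain ⟨c, hc⟩ := Ideal.exists_pow_inf_eq_pow_smul I (LinearMap.range A.mulVecLin)
  refine ⟨c, fun i v hv => ?_⟩
  have h1 : A.mulVecLin v ∈ (I ^ (i + c) • ⊤ ⊓ LinearMap.range A.mulVecLin :
      Submodule R (κ → R)) :=
    ⟨(Ideal.mem_smul_top_pi_iff _ _).2 hv, LinearMap.mem_range_self _ _⟩
  rw [hc _ (Nat.le_add_left _ _), Nat.add_sub_cancel] at h1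
  have h2 : A.mulVecLin v ∈ Submodule.map A.mulVecLin (I ^ i • ⊤) := by
    rw [Submodule.map_smul'', Submodule.map_top]
    exact Submodule.smul_mono le_rfl inf_le_right h1
  obtain ⟨u, hu, huv⟩ := h2
  obtain ⟨w, hw⟩ := hB (v - u) (by
    rw [Matrix.mulVec_sub, sub_eq_zero]
    exact huv.symm)
  refine ⟨w, fun l => ?_⟩
  rw [hw]
  simpa using (Ideal.mem_smul_top_pi_iff _ _).1 hu l

/-- The equational criterion for a finite system of equations in a flat `R ⧸ 𝔞`-module, with
coefficients lifted to `R`. -/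
lemma exists_factorization_of_flat_quotient [Finite κ] (𝔞 : Ideal R)
    {M : Type*} [AddCommGroup M] [Module R M] [Module (R ⧸ 𝔞) M] [IsScalarTower R (R ⧸ 𝔞) M]
    [Module.Flat (R ⧸ 𝔞) M] (A : Matrix κ ι R) (y : ι → M) (hy : A.smulVecLin M y = 0) :
    ∃ (m : ℕ) (C : Matrix ι (Fin m) R) (z : Fin m → M),
      C.smulVecLin M z = y ∧ ∀ k j, (A * C) k j ∈ 𝔞 := by
  classical
  have := Fintype.ofFinite κ
  let q := Ideal.Quotient.mk 𝔞
  have hq (r : R) (x : M) : q r • x = r • x := algebraMap_smul (R ⧸ 𝔞) r x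
  let F : (κ → R ⧸ 𝔞) →ₗ[R ⧸ 𝔞] (ι → R ⧸ 𝔞) := (A.map q).transpose.mulVecLin
  let X : (ι → R ⧸ 𝔞) →ₗ[R ⧸ 𝔞] M := Fintype.linearCombination (R ⧸ 𝔞) y
  have hXF : X ∘ₗ F = 0 := by
    refine LinearMap.pi_ext' fun k => LinearMap.ext_ring ?_
    have := congrFun hy k
    simpa [X, F, Fintype.linearCombination_apply, Matrix.smulVecLin_apply, hq] using this
  obtain ⟨m, a, z, hz, ha⟩ := Module.Flat.exists_factorization_of_comp_eq_zero_of_free hXF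
  choose C hC using fun (l : ι) (j : Fin m) =>
    Ideal.Quotient.mk_surjective (a (Pi.single l 1) j)
  refine ⟨m, Matrix.of C, fun j => z (Finsupp.single j 1), ?_, fun k j => ?_⟩
  · ext l
    have h1 : X (Pi.single l 1) = y l := by simp [X]
    rw [← h1, hz, LinearMap.comp_apply, ← Finsupp.univ_sum_single (a (Pi.single l 1)), map_sum,
      Matrix.smulVecLin_apply]
    refine Finset.sum_congr rfl fun j _ => ?_
    rw [Matrix.of_apply, ← hq, hC, ← map_smul, Finsupp.smul_single, smul_eq_mul, mul_one]
  · rw [← Ideal.Quotient.eq_zero_iff_mem]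
    have h1 := DFunLike.congr_fun (LinearMap.congr_fun ha (Pi.single k 1)) j
    have h2 : F (Pi.single k 1) = ∑ l, q (A k l) • Pi.single l 1 := by
      ext l
      simp [F, Finset.sum_apply, Pi.single_apply]
    rw [LinearMap.comp_apply, h2, map_sum] at h1
    simpa [Matrix.mul_apply, Finsupp.finsetSum_apply, hC, q] using h1

end Approximation

namespace InvLimit

variable {R : Type*} [CommRing R] {N : ℕ → Type*} [∀ i, AddCommGroup (N i)]
  [∀ i, Module R (N i)] {f : ∀ i, N (i + 1) →ₗ[R] N i}

variable (f) in
/-- The projection of the inverse limit to its `i`-th term. -/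
def π (i : ℕ) : InvLimit N f →ₗ[R] N i :=
  (LinearMap.proj i).comp (InvLimit N f).subtype

lemma map_π_succ (i : ℕ) (x : InvLimit N f) : f i (π f (i + 1) x) = π f i x :=
  x.2 i

lemma ext_π {x y : InvLimit N f} (h : ∀ i, π f i x = π f i y) : x = y :=
  Subtype.ext (funext h)

lemma π_eq_of_le {x y : InvLimit N f} {i j : ℕ} (hij : i ≤ j) (h : π f j x = π f j y) :
    π f i x = π f i y := by
  induction j, hij using Nat.le_induction with
  | base => exact h
  | succ j _ ih => exact ih (by rw [← map_π_succ, h, map_π_succ])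

/-- In a tower with surjective transition maps every element extends to a compatible sequence. -/
lemma exists_compatible_extension (i : ℕ) : ∀ {N : ℕ → Type*} [∀ i, AddCommGroup (N i)]
    [∀ i, Module R (N i)] (f : ∀ i, N (i + 1) →ₗ[R] N i) (_ : ∀ i, Function.Surjective (f i))
    (x : N i), ∃ y : ∀ n, N n, (∀ n, f n (y (n + 1)) = y n) ∧ y i = x := by
  induction i with
  | zero =>
    intro N _ _ f hf x
    choose s hs using hf
    exact ⟨fun n => Nat.rec x (fun m y => s m y) n, fun n => hs n _, rfl⟩
  | succ i ih =>
    intro N _ _ f hf x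
    obtain ⟨y, hy, hyx⟩ := ih (N := fun n => N (n + 1)) (fun n => f (n + 1)) (fun n => hf _) x
    refine ⟨fun n => Nat.casesOn n (f 0 (y 0)) y, fun n => ?_, hyx⟩
    cases n with
    | zero => rfl
    | succ n => exact hy n

lemma π_surjective (hf : ∀ i, Function.Surjective (f i)) (i : ℕ) :
    Function.Surjective (π f i) := by
  intro x
  obtain ⟨y, hy, hyx⟩ := exists_compatible_extension i f hf x
  exact ⟨⟨y, hy⟩, hyx⟩

lemma π_smulVecLin {ι κ : Type*} [Fintype ι] (A : Matrix κ ι R) (y : ι → InvLimit N f) (k : κ)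
    (i : ℕ) : π f i (A.smulVecLin _ y k) = A.smulVecLin _ (fun l => π f i (y l)) k :=
  A.map_smulVecLin _ _ _

lemma smul_eq_zero_of_mem_pow (I : Ideal R)
    [∀ i, Module (R ⧸ I ^ i) (N i)] [∀ i, IsScalarTower R (R ⧸ I ^ i) (N i)]
    {i : ℕ} {r : R} (hr : r ∈ I ^ i) (x : N i) : r • x = 0 := by
  have := smul_top_le_ker (I ^ i) (LinearMap.id : N i →ₗ[R] N i)
    (Submodule.smul_mem_smul hr (Submodule.mem_top (x := x)))
  simpa using this

/-- The Mittag-Leffler property of the kernels of a linear system on the tower: approximate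
solutions are close to combinations of the solutions over `R`. -/
lemma exists_forall_π_eq_relation [IsNoetherianRing R] (I : Ideal R)
    [∀ i, Module (R ⧸ I ^ i) (N i)] [∀ i, IsScalarTower R (R ⧸ I ^ i) (N i)]
    [∀ i, Module.Flat (R ⧸ I ^ i) (N i)]
    (hf : ∀ i, Function.Surjective (f i))
    {ι κ τ : Type*} [Fintype ι] [Finite κ] [Fintype τ] (A : Matrix κ ι R) (B : Matrix ι τ R)
    (hB : ∀ v : ι → R, A.mulVec v = 0 → ∃ w, B.mulVec w = v) :
    ∃ c, ∀ i, ∀ y : ι → InvLimit N f, (∀ k, π f (i + c) (A.smulVecLin _ y k) = 0) →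
      ∃ w : τ → InvLimit N f, ∀ l, π f i (B.smulVecLin _ w l) = π f i (y l) := by
  obtain ⟨c, hc⟩ := exists_forall_close_to_relation I A B hB
  refine ⟨c, fun i y hy => ?_⟩
  obtain ⟨m, C, z, hz, hAC⟩ := exists_factorization_of_flat_quotient (I ^ (i + c)) A
    (fun l => π f (i + c) (y l)) (by ext k; rw [← π_smulVecLin, hy]; rfl)
  choose Z hZ using fun j => π_surjective hf (i + c) (z j)
  choose W hW using fun j => hc i (fun l => C l j) (fun k => hAC k j)
  let D : Matrix τ (Fin m) R := Matrix.of fun t j => W j t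
  refine ⟨D.smulVecLin _ Z, fun l => ?_⟩
  rw [← Matrix.smulVecLin_mul]
  have h1 : π f i (y l) = π f i (C.smulVecLin _ Z l) := by
    refine π_eq_of_le (Nat.le_add_right i c) ?_
    rw [π_smulVecLin, ← congrFun hz l]
    simp only [hZ]
  rw [h1, ← sub_eq_zero, ← map_sub, ← neg_eq_zero, ← map_neg, neg_sub, Matrix.smulVecLin_apply,
    Matrix.smulVecLin_apply, ← Finset.sum_sub_distrib, map_sum]
  refine Finset.sum_eq_zero fun j _ => ?_
  rw [← sub_smul, map_smul]
  exact smul_eq_zero_of_mem_pow I (hW j l) _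

/-- A linear system on the inverse limit which is solvable on each term of the tower is
solvable. -/
lemma exists_smulVecLin_eq [IsNoetherianRing R] (I : Ideal R)
    [∀ i, Module (R ⧸ I ^ i) (N i)] [∀ i, IsScalarTower R (R ⧸ I ^ i) (N i)]
    [∀ i, Module.Flat (R ⧸ I ^ i) (N i)]
    (hf : ∀ i, Function.Surjective (f i))
    {ι κ : Type*} [Fintype ι] [Finite κ] (A : Matrix κ ι R) (n : κ → InvLimit N f)
    (hn : ∀ i, ∃ y : ι → InvLimit N f, ∀ k, π f i (A.smulVecLin _ y k) = π f i (n k)) :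
    ∃ y : ι → InvLimit N f, A.smulVecLin _ y = n := by
  obtain ⟨t, B, hAB, hB⟩ := A.exists_relation_matrix
  obtain ⟨c, hc⟩ := exists_forall_π_eq_relation (f := f) I hf A B hB
  have step (i : ℕ) (y : ι → InvLimit N f)
      (hy : ∀ k, π f (i + c) (A.smulVecLin _ y k) = π f (i + c) (n k)) :
      ∃ y' : ι → InvLimit N f,
        (∀ k, π f (i + 1 + c) (A.smulVecLin _ y' k) = π f (i + 1 + c) (n k)) ∧
          ∀ l, π f i (y' l) = π f i (y l) := by
    obtain ⟨u, hu⟩ := hn (i + 1 + c)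
    obtain ⟨w, hw⟩ := hc i (u - y) fun k => by
      rw [map_sub, Pi.sub_apply, map_sub, hy, sub_eq_zero]
      exact π_eq_of_le (by lia) (hu k)
    refine ⟨u - B.smulVecLin _ w, fun k => ?_, fun l => ?_⟩
    · have h0 : A.smulVecLin _ (B.smulVecLin _ w) = 0 := by
        rw [← Matrix.smulVecLin_mul, hAB]
        ext k
        simp [Matrix.smulVecLin_apply]
      rw [map_sub, h0, sub_zero, hu]
    · rw [Pi.sub_apply, map_sub, hw, Pi.sub_apply, map_sub, sub_sub_cancel]
  choose! S hS hS' using step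
  obtain ⟨y₀, hy₀⟩ := hn (0 + c)
  let Y : ℕ → ι → InvLimit N f := fun i => Nat.rec y₀ S i
  have hY (i : ℕ) : ∀ k, π f (i + c) (A.smulVecLin _ (Y i) k) = π f (i + c) (n k) := by
    induction i with
    | zero => exact hy₀
    | succ i ih => exact hS i (Y i) ih
  let z : ι → InvLimit N f := fun l => ⟨fun i => π f i (Y i l), fun i => by
    rw [map_π_succ]
    exact hS' i (Y i) (hY i) l⟩
  refine ⟨z, funext fun k => ext_π fun i => ?_⟩
  have h1 : π f i (A.smulVecLin _ z k) = π f i (A.smulVecLin _ (Y i) k) := by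
    rw [π_smulVecLin, π_smulVecLin]
    rfl
  rw [h1]
  exact π_eq_of_le (Nat.le_add_right i c) (hY i k)

theorem flat [IsNoetherianRing R] (I : Ideal R)
    [∀ i, Module (R ⧸ I ^ i) (N i)] [∀ i, IsScalarTower R (R ⧸ I ^ i) (N i)]
    [∀ i, Module.Flat (R ⧸ I ^ i) (N i)]
    (hf : ∀ i, Function.Surjective (f i)) : Module.Flat R (InvLimit N f) := by
  refine Module.Flat.of_forall_isTrivialRelation fun {l a x} hax => ?_
  let A : Matrix Unit (Fin l) R := Matrix.of fun _ => a
  obtain ⟨t, B, hAB, hB⟩ := A.exists_relation_matrix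
  obtain ⟨c, hc⟩ := exists_forall_π_eq_relation (f := f) I hf A B hB
  obtain ⟨w, rfl⟩ := exists_smulVecLin_eq I hf B x fun i => hc i x fun k => by
    rw [Matrix.smulVecLin_apply]
    exact (congrArg _ hax).trans (map_zero _)
  exact ⟨t, B, w, fun i => Matrix.smulVecLin_apply _ _ _, fun j => congrFun₂ hAB () j⟩

/-- Ideal multiples of the inverse limit are detected on the terms of the tower. -/
theorem mem_smul_top_of_forall [IsNoetherianRing R] (I : Ideal R)
    [∀ i, Module (R ⧸ I ^ i) (N i)] [∀ i, IsScalarTower R (R ⧸ I ^ i) (N i)]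
    [∀ i, Module.Flat (R ⧸ I ^ i) (N i)]
    (hf : ∀ i, Function.Surjective (f i)) (J : Ideal R)
    (n : InvLimit N f) (hn : ∀ i, π f i n ∈ (J • ⊤ : Submodule R (N i))) :
    n ∈ (J • ⊤ : Submodule R (InvLimit N f)) := by
  obtain ⟨s, a, rfl⟩ := Submodule.fg_iff_exists_fin_generating_family.1
    (IsNoetherian.noetherian J)
  let A : Matrix Unit (Fin s) R := Matrix.of fun _ => a
  obtain ⟨y, hy⟩ := exists_smulVecLin_eq I hf A (fun _ => n) fun i => by
    have h1 := hn i
    rw [← LinearMap.range_eq_top.2 (π_surjective hf i), ← Submodule.map_top,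
      ← Submodule.map_smul''] at h1
    obtain ⟨x, hx, hxn⟩ := h1
    have h2 : (Submodule.span R (Set.range a) • ⊤ : Submodule R (InvLimit N f)) ≤
        LinearMap.range (LinearMap.proj () ∘ₗ A.smulVecLin (InvLimit N f)) := by
      refine Submodule.smul_le.2 fun r hr v _ => ?_
      obtain ⟨b, rfl⟩ := (Submodule.mem_span_range_iff_exists_fun R).1 hr
      refine ⟨fun l => b l • v, ?_⟩
      simp [A, Matrix.smulVecLin_apply, Finset.sum_smul, smul_smul, mul_comm]
    obtain ⟨y, rfl⟩ := h2 hx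
    exact ⟨y, fun _ => hxn⟩
  rw [← congrFun hy (), Matrix.smulVecLin_apply]
  exact Submodule.sum_mem _ fun l _ =>
    Submodule.smul_mem_smul (Submodule.subset_span ⟨l, rfl⟩) trivial

/-- If the kernels of the transition maps are as small as possible, then so are the kernels of the
projections from the inverse limit to the terms of the tower. -/
lemma π_mem_pow_smul_top (hf : ∀ i, Function.Surjective (f i)) (I : Ideal R)
    (hker : ∀ i, LinearMap.ker (f i) ≤ I ^ i • ⊤) {i : ℕ} {x : InvLimit N f} (hx : π f i x = 0)
    (j : ℕ) : π f j x ∈ (I ^ i • ⊤ : Submodule R (N j)) := by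
  rcases le_total j i with hji | hij
  · rw [π_eq_of_le hji (hx.trans (map_zero _).symm), map_zero]
    exact zero_mem _
  induction j, hij using Nat.le_induction with
  | base => rw [hx]; exact zero_mem _
  | succ j hij ih =>
    rw [← LinearMap.range_eq_top.2 (hf j), ← Submodule.map_top, ← Submodule.map_smul''] at ih
    obtain ⟨u, hu, hux⟩ := ih
    have h1 : π f (j + 1) x - u ∈ LinearMap.ker (f j) := by
      rw [LinearMap.mem_ker, map_sub, map_π_succ, hux, sub_self]
    rw [← sub_add_cancel (π f (j + 1) x) u]
    exact add_mem (Submodule.smul_mono_left (Ideal.pow_le_pow_right hij) (hker j h1)) hu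

/-- A compatible sequence of classes modulo `J` lifts to the inverse limit. -/
lemma exists_lift_quotient (hf : ∀ i, Function.Surjective (f i)) (J : Ideal R)
    (y : ∀ i, N i ⧸ (J • ⊤ : Submodule R (N i)))
    (hy : ∀ i (u : N (i + 1)), Submodule.Quotient.mk u = y (i + 1) →
      Submodule.Quotient.mk (f i u) = y i) :
    ∃ x : InvLimit N f, ∀ i, Submodule.Quotient.mk (π f i x) = y i := by
  have step (i : ℕ) (n : N i) (hn : Submodule.Quotient.mk n = y i) :
      ∃ n' : N (i + 1), Submodule.Quotient.mk n' = y (i + 1) ∧ f i n' = n := by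
    obtain ⟨u, hu⟩ := Submodule.Quotient.mk_surjective _ (y (i + 1))
    have h1 : f i u - n ∈ (J • ⊤ : Submodule R (N i)) :=
      (Submodule.Quotient.eq _).1 ((hy i u hu).trans hn.symm)
    rw [← LinearMap.range_eq_top.2 (hf i), ← Submodule.map_top, ← Submodule.map_smul''] at h1
    obtain ⟨v, hv, hvu⟩ := h1
    refine ⟨u - v, ?_, by rw [map_sub, hvu, sub_sub_cancel]⟩
    rw [← hu, Submodule.Quotient.eq, sub_sub_cancel_left]
    exact neg_mem hv
  choose! S hS hS' using step
  obtain ⟨n₀, hn₀⟩ := Submodule.Quotient.mk_surjective _ (y 0)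
  let Y : ∀ i, N i := fun i => Nat.rec n₀ S i
  have hY (i : ℕ) : Submodule.Quotient.mk (Y i) = y i := by
    induction i with
    | zero => exact hn₀
    | succ i ih => exact hS i (Y i) ih
  exact ⟨⟨Y, fun i => hS' i (Y i) (hY i)⟩, hY⟩

end InvLimit

/-- Let `R` be a complete Noetherian local commutative ring, `I` an ideal, and
`{N_i}` a projective system with `N_i` flat over `R/Iⁱ` and transition maps inducing isomorphisms
`N_{i+1}/IⁱN_{i+1} ≅ N_i`.  Then `N = lim N_i` is flat over `R`, the natural maps `N/IⁱN → N_i`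
are isomorphisms, and for every ideal `J` of `R` the natural map `N/JN → lim (N_i/JN_i)` is an
isomorphism. -/
theorem flat_invLimit_of_tower {R : Type*} [CommRing R] [IsNoetherianRing R] [IsLocalRing R]
    [IsAdicComplete (IsLocalRing.maximalIdeal R) R]
    (I : Ideal R)
    (N : ℕ → Type*) [∀ i, AddCommGroup (N i)] [∀ i, Module R (N i)]
    [∀ i, Module (R ⧸ I ^ i) (N i)] [∀ i, IsScalarTower R (R ⧸ I ^ i) (N i)]
    [∀ i, Module.Flat (R ⧸ I ^ i) (N i)]
    (f : ∀ i, N (i + 1) →ₗ[R] N i)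
    (hbij : ∀ i, Function.Bijective
      (Submodule.liftQ ((I ^ i) • ⊤ : Submodule R (N (i + 1))) (f i)
        (smul_top_le_ker (I ^ i) (f i)))) :
    Module.Flat R ↥(InvLimit N f) ∧
    (∀ i, Function.Bijective
      (Submodule.liftQ ((I ^ i) • ⊤ : Submodule R ↥(InvLimit N f))
        ((LinearMap.proj i).comp (InvLimit N f).subtype)
        (smul_top_le_ker (I ^ i) ((LinearMap.proj i).comp (InvLimit N f).subtype)))) ∧
    (∀ J : Ideal R,
      ∃ e : (↥(InvLimit N f) ⧸ (J • ⊤ : Submodule R ↥(InvLimit N f))) ≃ₗ[R]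
          ↥(InvLimit (fun i => N i ⧸ (J • ⊤ : Submodule R (N i)))
              (fun i => Submodule.mapQ _ _ (f i)
                (by
                  rw [← Submodule.map_le_iff_le_comap, Submodule.map_smul'']
                  exact Submodule.smul_mono le_rfl le_top))),
        ∀ (x : ↥(InvLimit N f)) (i : ℕ),
          (e (Submodule.Quotient.mk x)).1 i = Submodule.Quotient.mk (x.1 i)) := by
  have hf (i : ℕ) : Function.Surjective (f i) := fun x => by
    obtain ⟨q, rfl⟩ := (hbij i).2 x
    obtain ⟨u, rfl⟩ := Submodule.Quotient.mk_surjective _ q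
    exact ⟨u, rfl⟩
  have hker (i : ℕ) : LinearMap.ker (f i) ≤ I ^ i • ⊤ := fun x hx =>
    (Submodule.Quotient.mk_eq_zero _).1 ((hbij i).1 (by simpa using hx))
  refine ⟨InvLimit.flat I hf, fun i => ⟨?_, fun x => ?_⟩, fun J => ?_⟩
  · rw [← LinearMap.ker_eq_bot, LinearMap.ker_eq_bot']
    intro q hq
    obtain ⟨x, rfl⟩ := Submodule.Quotient.mk_surjective _ q
    exact (Submodule.Quotient.mk_eq_zero _).2 (InvLimit.mem_smul_top_of_forall I hf _ x
      (InvLimit.π_mem_pow_smul_top hf I hker hq))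
  · obtain ⟨y, hy⟩ := InvLimit.π_surjective hf i x
    exact ⟨Submodule.Quotient.mk y, hy⟩
  · have hle (i : ℕ) : (J • ⊤ : Submodule R (InvLimit N f)) ≤
        (J • ⊤ : Submodule R (N i)).comap (InvLimit.π f i) := by
      rw [← Submodule.map_le_iff_le_comap, Submodule.map_smul'']
      exact Submodule.smul_mono le_rfl le_top
    let e₀ := LinearMap.codRestrict (InvLimit (fun i => N i ⧸ (J • ⊤ : Submodule R (N i)))
        (fun i => Submodule.mapQ _ _ (f i) (by
          rw [← Submodule.map_le_iff_le_comap, Submodule.map_smul'']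
          exact Submodule.smul_mono le_rfl le_top)))
      (LinearMap.pi fun i => Submodule.mapQ (J • ⊤ : Submodule R (InvLimit N f)) _
        (InvLimit.π f i) (hle i)) (fun q i => by
          obtain ⟨x, rfl⟩ := Submodule.Quotient.mk_surjective _ q
          exact congrArg Submodule.Quotient.mk (InvLimit.map_π_succ i x))
    refine ⟨LinearEquiv.ofBijective e₀ ⟨?_, fun y => ?_⟩, fun x i => rfl⟩
    · rw [← LinearMap.ker_eq_bot, LinearMap.ker_eq_bot']
      intro q hq
      obtain ⟨x, rfl⟩ := Submodule.Quotient.mk_surjective _ q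
      exact (Submodule.Quotient.mk_eq_zero _).2 (InvLimit.mem_smul_top_of_forall I hf J x
        fun i => (Submodule.Quotient.mk_eq_zero _).1 (congrFun (congrArg Subtype.val hq) i))
    · obtain ⟨x, hx⟩ := InvLimit.exists_lift_quotient hf J y.1 fun i u hu => by
        rw [← y.2 i, ← hu]
        rfl
      exact ⟨Submodule.Quotient.mk x, Subtype.ext (funext hx)⟩
end

section
/- Let O be a commutative ring, let I be the set of positive integers, let 𝔉 be a non-principal ultrafilter on I, and let R = ∏_{i∈I} O, R_𝔉 = S_𝔉^{-1}R as in the context. Suppose that for each i ∈ I, M_i is an O-module equipped with a decreasing filtration M_i ⊇ M_{i,1} ⊇ M_{i,2} ⊇ ⋯ by O-submodules. Then the natural map ∏_{i∈I} M_i → lim_n ((∏_{i∈I} M_i/M_{i,n}) ⊗_R R_𝔉) is surjective, and its kernel contains every element (a_i)_{i∈I} with the property that for every n there exists I_n ∈ 𝔉 with a_i ∈ M_{i,n} for all i ∈ I_n. -/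
open TensorProduct

section Ultra

variable {O : Type*} [CommRing O]

open Classical in
/-- The multiplicative set `S_𝔉 ⊆ ∏ O` of idempotents `e_J`, `J ∈ 𝔉`. -/
noncomputable def idemMonoid (O : Type*) [CommRing O] (F : Ultrafilter ℕ) :
    Submonoid (ℕ → O) where
  carrier := {e | ∃ J : Set ℕ, J ∈ F ∧ e = fun i => if i ∈ J then 1 else 0}
  one_mem' := ⟨Set.univ, Filter.univ_mem, by funext i; simp⟩
  mul_mem' := by
    rintro e₁ e₂ ⟨J, hJ, rfl⟩ ⟨K, hK, rfl⟩
    refine ⟨J ∩ K, Filter.inter_mem hJ hK, ?_⟩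
    funext i
    by_cases hJ' : i ∈ J <;> by_cases hK' : i ∈ K <;>
      simp [hJ', hK', Set.mem_inter_iff]

/-- `R_𝔉 = S_𝔉⁻¹ R`. -/
noncomputable abbrev RUlt (O : Type*) [CommRing O] (F : Ultrafilter ℕ) :=
  Localization (idemMonoid O F)

/-- The componentwise transition map `∏ᵢ Mᵢ/M_{i,n+1} → ∏ᵢ Mᵢ/M_{i,n}`, which is linear over the
product ring `∏ᵢ O`. -/
def piMapQ (M : ℕ → Type*) [∀ i, AddCommGroup (M i)] [∀ i, Module O (M i)]
    (Filt : ∀ i, ℕ → Submodule O (M i))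
    (hFilt : ∀ i n, Filt i (n + 1) ≤ Filt i n) (n : ℕ) :
    (∀ i, M i ⧸ Filt i (n + 1)) →ₗ[∀ _ : ℕ, O] (∀ i, M i ⧸ Filt i n) where
  toFun x i := Submodule.mapQ _ _ LinearMap.id
    (by rw [Submodule.comap_id]; exact hFilt i n) (x i)
  map_add' x y := by funext i; simp
  map_smul' r x := by funext i; exact map_smul _ (r i) (x i)

/-- The transition maps of the system `n ↦ (∏ᵢ Mᵢ/M_{i,n}) ⊗_R R_𝔉`. -/
noncomputable def tUltMap (F : Ultrafilter ℕ) (M : ℕ → Type*) [∀ i, AddCommGroup (M i)]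
    [∀ i, Module O (M i)] (Filt : ∀ i, ℕ → Submodule O (M i))
    (hFilt : ∀ i n, Filt i (n + 1) ≤ Filt i n) (n : ℕ) :
    ((∀ i, M i ⧸ Filt i (n + 1)) ⊗[∀ _ : ℕ, O] RUlt O F) →ₗ[∀ _ : ℕ, O]
      ((∀ i, M i ⧸ Filt i n) ⊗[∀ _ : ℕ, O] RUlt O F) :=
  TensorProduct.map (piMapQ M Filt hFilt n) LinearMap.id

/-- The natural map `∏ᵢ Mᵢ → lim_n ((∏ᵢ Mᵢ/M_{i,n}) ⊗_R R_𝔉)`. -/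
noncomputable def thetaUlt (F : Ultrafilter ℕ) (M : ℕ → Type*) [∀ i, AddCommGroup (M i)]
    [∀ i, Module O (M i)] (Filt : ∀ i, ℕ → Submodule O (M i))
    (hFilt : ∀ i n, Filt i (n + 1) ≤ Filt i n) (x : ∀ i, M i) :
    ↥(InvLimit (fun n => (∀ i, M i ⧸ Filt i n) ⊗[∀ _ : ℕ, O] RUlt O F)
        (tUltMap F M Filt hFilt)) :=
  ⟨fun n => (fun i => Submodule.Quotient.mk (x i)) ⊗ₜ[∀ _ : ℕ, O] (1 : RUlt O F), by
    intro n
    show TensorProduct.map _ _ _ = _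
    rw [TensorProduct.map_tmul]
    congr 1⟩

end Ultra

section Ultra

variable {O : Type*} [CommRing O] {F : Ultrafilter ℕ}

theorem algebraMap_RUlt_surjective :
    Function.Surjective (algebraMap (ℕ → O) (RUlt O F)) := by
  intro z
  obtain ⟨r, s, rfl⟩ := IsLocalization.exists_mk'_eq (idemMonoid O F) z
  refine ⟨r, ?_⟩
  rw [IsLocalization.eq_mk'_iff_mul_eq, ← map_mul,
    IsLocalization.eq_iff_exists (idemMonoid O F)]
  refine ⟨s, ?_⟩
  obtain ⟨_, J, -, rfl⟩ := s
  funext i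
  by_cases h : i ∈ J <;> simp [h]

theorem exists_tmul_one_eq {X : Type*} [AddCommGroup X] [Module (ℕ → O) X]
    (z : X ⊗[ℕ → O] RUlt O F) : ∃ x : X, x ⊗ₜ[ℕ → O] (1 : RUlt O F) = z := by
  induction z with
  | zero => exact ⟨0, TensorProduct.zero_tmul _ _⟩
  | tmul x s =>
    obtain ⟨r, rfl⟩ := algebraMap_RUlt_surjective s
    refine ⟨r • x, (TensorProduct.smul_tmul r x 1).trans ?_⟩
    exact congrArg (x ⊗ₜ ·) (Algebra.algebraMap_eq_smul_one r).symm
  | add a b ha hb =>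
    obtain ⟨x, rfl⟩ := ha
    obtain ⟨y, rfl⟩ := hb
    exact ⟨x + y, TensorProduct.add_tmul _ _ _⟩

theorem tmul_one_eq_iff_exists_smul {X : Type*} [AddCommGroup X] [Module (ℕ → O) X] (x y : X) :
    x ⊗ₜ[ℕ → O] (1 : RUlt O F) = y ⊗ₜ[ℕ → O] (1 : RUlt O F) ↔
      ∃ s : idemMonoid O F, s • x = s • y := by
  rw [← IsLocalizedModule.eq_iff_exists (idemMonoid O F)
    (TensorProduct.mk (ℕ → O) (RUlt O F) X 1),
    ← (TensorProduct.comm (ℕ → O) X (RUlt O F)).injective.eq_iff]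
  rfl

theorem tmul_one_eq_iff_eventuallyEq {X : ℕ → Type*} [∀ i, AddCommGroup (X i)]
    [∀ i, Module O (X i)] (x y : ∀ i, X i) :
    x ⊗ₜ[∀ _ : ℕ, O] (1 : RUlt O F) = y ⊗ₜ[∀ _ : ℕ, O] (1 : RUlt O F) ↔
      ∀ᶠ i in (F : Filter ℕ), x i = y i := by
  classical
  rw [tmul_one_eq_iff_exists_smul]
  constructor
  · rintro ⟨⟨_, J, hJ, rfl⟩, h⟩
    filter_upwards [hJ] with i hi
    have := congrFun h i
    simpa [Submonoid.smul_def, hi] using this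
  · intro h
    refine ⟨⟨_, _, h, rfl⟩, funext fun i => ?_⟩
    by_cases hi : x i = y i <;> simp [Submonoid.smul_def, hi]

end Ultra

theorem Ultrafilter.le_atTop_of_forall_ne_pure {F : Ultrafilter ℕ} (hF : ∀ i : ℕ, F ≠ pure i) :
    (F : Filter ℕ) ≤ Filter.atTop := by
  rw [← Nat.cofinite_eq_atTop, Filter.le_cofinite_iff_compl_singleton_mem]
  intro i
  by_contra h
  have hi : {i} ∈ F := by simpa using Ultrafilter.compl_notMem_iff.mp h
  exact hF i (Ultrafilter.coe_le_coe.mp (Filter.le_pure_iff.mpr hi))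

/-- Sequences that are eventually successively congruent along a non-principal ultrafilter have a
diagonal limit. -/
theorem exists_eventually_sub_mem {F : Filter ℕ} (hF : F ≤ Filter.atTop)
    {O : Type*} [Ring O] {M : ℕ → Type*} [∀ i, AddCommGroup (M i)] [∀ i, Module O (M i)]
    {Filt : ∀ i, ℕ → Submodule O (M i)} (hFilt : ∀ i, Antitone (Filt i))
    (m : ℕ → ∀ i, M i) (hm : ∀ n, ∀ᶠ i in F, m (n + 1) i - m n i ∈ Filt i n) :
    ∃ a : ∀ i, M i, ∀ n, ∀ᶠ i in F, a i - m n i ∈ Filt i n := by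
  classical
  let P (i n : ℕ) : Prop := ∀ k < n, m (k + 1) i - m k i ∈ Filt i k
  refine ⟨fun i => m (Nat.findGreatest (P i) i) i, fun n => ?_⟩
  have hP : ∀ᶠ i in F, P i n := (Filter.eventually_all_finite (Set.finite_lt_nat n)).mpr
    fun k _ => hm k
  filter_upwards [hP, hF (Filter.eventually_ge_atTop n)] with i hi hni
  have hle : n ≤ Nat.findGreatest (P i) i := Nat.le_findGreatest hni hi
  have hspec : P i (Nat.findGreatest (P i) i) := Nat.findGreatest_spec hni hi
  generalize Nat.findGreatest (P i) i = N at hle hspec ⊢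
  induction N, hle using Nat.le_induction with
  | base => simp
  | succ k hk ih =>
    rw [← sub_add_sub_cancel (m (k + 1) i) (m k i)]
    exact add_mem (hFilt i hk (hspec k k.lt_succ_self))
      (ih fun j hj => hspec j (hj.trans k.lt_succ_self))

/-- Let `𝔉` be a non-principal ultrafilter on the index set, `R = ∏ᵢ O` and
`R_𝔉 = S_𝔉⁻¹R`, and `{M_{i,n}}ₙ` decreasing filtrations on `O`-modules `Mᵢ`.  Then the natural
map `∏ᵢ Mᵢ → lim_n ((∏ᵢ Mᵢ/M_{i,n}) ⊗_R R_𝔉)` is surjective, and its kernel contains every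
element `(aᵢ)` such that for each `n` there is `Iₙ ∈ 𝔉` with `aᵢ ∈ M_{i,n}` for all `i ∈ Iₙ`. -/
theorem thetaUlt_surjective_and_kernel {O : Type*} [CommRing O]
    (F : Ultrafilter ℕ) (hF : ∀ i : ℕ, F ≠ (pure i : Ultrafilter ℕ))
    (M : ℕ → Type*) [∀ i, AddCommGroup (M i)] [∀ i, Module O (M i)]
    (Filt : ∀ i, ℕ → Submodule O (M i))
    (hFilt : ∀ i n, Filt i (n + 1) ≤ Filt i n) :
    Function.Surjective (thetaUlt F M Filt hFilt) ∧
    ∀ a : ∀ i, M i,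
      (∀ n : ℕ, ∃ In : Set ℕ, In ∈ F ∧ ∀ i ∈ In, a i ∈ Filt i n) →
        thetaUlt F M Filt hFilt a = 0 := by
  refine ⟨fun y => ?_, fun a ha => Subtype.ext (funext fun n => ?_)⟩
  · choose x hx using fun n => exists_tmul_one_eq (O := O) (F := F) (y.1 n)
    choose m hm using fun n i => Submodule.Quotient.mk_surjective (Filt i n) (x n i)
    obtain ⟨a, ha⟩ := exists_eventually_sub_mem (F.le_atTop_of_forall_ne_pure hF)
      (fun i => antitone_nat_of_succ_le (hFilt i)) m fun n => by
        have h := y.2 n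
        rw [← hx n, ← hx (n + 1), tUltMap, TensorProduct.map_tmul, LinearMap.id_apply,
          tmul_one_eq_iff_eventuallyEq] at h
        filter_upwards [h] with i hi
        rw [← hm n i] at hi
        change Submodule.mapQ (Filt i (n + 1)) (Filt i n) LinearMap.id (hFilt i n)
          (x (n + 1) i) = _ at hi
        rw [← hm (n + 1) i] at hi
        exact (Submodule.Quotient.eq _).mp hi
    refine ⟨a, Subtype.ext (funext fun n => ?_)⟩
    rw [← hx n]
    refine (tmul_one_eq_iff_eventuallyEq _ _).mpr ?_
    filter_upwards [ha n] with i hi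
    rw [← hm n i]
    exact (Submodule.Quotient.eq _).mpr hi
  · obtain ⟨J, hJ, h⟩ := ha n
    refine Eq.trans ((tmul_one_eq_iff_eventuallyEq _ 0).mpr ?_) (TensorProduct.zero_tmul _ _)
    filter_upwards [hJ] with i hi
    exact (Submodule.Quotient.mk_eq_zero _).mpr (h i hi)
end

section
/- Let F be a field, R a left Noetherian associative unital F-algebra, and J a two-sided ideal of R such that R/J is finite-dimensional over F, and assume (R,J) has the Artin–Rees property. Let x ∈ J be an element lying in the center of R, and let M be a finitely generated left R-module with no x-torsion (i.e. xm = 0 implies m = 0). Suppose there is a polynomial p ∈ ℚ[t] of degree δ ≥ 1 such that dim_F(M/JᵏM) = p(k) for all sufficiently large k. Then dim_R(M/xM) = δ − 1, i.e. limsup_{k→∞} log(dim_F(M/(JᵏM + xM)))/log(k) = δ − 1 (while dim_R(M) = δ). -/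
universe v

section GK

variable {F : Type*} [Field F] {R : Type*} [Ring R] [Algebra F R]

/-- The `R`-submodule `Jᵏ⋅M` of `M`, where `J` is a (two-sided ideal) `F`-subspace of `R`. -/
def powSMulTop (J : Submodule F R) (k : ℕ) (M : Type*) [AddCommGroup M] [Module R M] :
    Submodule R M :=
  Submodule.span R {x : M | ∃ a ∈ (J ^ k : Submodule F R), ∃ m : M, x = a • m}

/-- The `R`-submodule `Jᵏ⋅N` of `M`, for `N` a submodule of `M`. -/
def powSMulIn (J : Submodule F R) (k : ℕ) {M : Type*} [AddCommGroup M] [Module R M]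
    (N : Submodule R M) : Submodule R M :=
  Submodule.span R {x : M | ∃ a ∈ (J ^ k : Submodule F R), ∃ m ∈ N, x = a • m}

/-- The Gelfand–Kirillov dimension
`dim_R(M) = limsup_k log (dim_F (M/JᵏM)) / log k`. -/
noncomputable def GKdim (J : Submodule F R) (M : Type*) [AddCommGroup M] [Module R M]
    [Module F M] [IsScalarTower F R M] : ℝ :=
  Filter.limsup (fun k : ℕ =>
    Real.log (Module.finrank F (M ⧸ powSMulTop J k M)) / Real.log k) Filter.atTop

/-- The submodule `x⋅M` for a central element `x ∈ R`. -/
def elemSMulTop (x : R) (M : Type*) [AddCommGroup M] [Module R M] : Submodule R M :=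
  Submodule.span R (Set.range fun m : M => x • m)

end GK

/-- The Artin–Rees property for `(R, J)`: for every finitely generated `M` and every submodule
`N ⊆ M` there is `c` with `J^{k+c}M ∩ N ⊆ JᵏN` for all `k`. -/
def ArtinReesProp.{w, u₁, u₂} {F : Type u₁} [Field F] {R : Type u₂} [Ring R] [Algebra F R]
    (J : Submodule F R) : Prop :=
  ∀ (M : Type w) [AddCommGroup M] [Module R M], Module.Finite R M →
    ∀ N : Submodule R M, ∃ c : ℕ, ∀ k : ℕ,
      powSMulTop J (k + c) M ⊓ N ≤ powSMulIn J k N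

open Filter Topology

namespace Polynomial

/-- A polynomial of degree `d` with positive leading coefficient grows like `x ^ d`. -/
theorem tendsto_log_eval_div_log (P : Polynomial ℝ) (hP : 0 < P.leadingCoeff) :
    Tendsto (fun x : ℝ => Real.log (P.eval x) / Real.log x) atTop (𝓝 (P.natDegree : ℝ)) := by
  have hratio : Tendsto (fun x : ℝ => P.eval x / x ^ P.natDegree) atTop (𝓝 P.leadingCoeff) := by
    have hP0 : P ≠ 0 := leadingCoeff_ne_zero.mp hP.ne'
    simpa using div_tendsto_atTop_leadingCoeff_div_of_degree_eq P (X ^ P.natDegree)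
      (by rw [degree_X_pow, degree_eq_natDegree hP0])
  have hzero : Tendsto (fun x : ℝ => Real.log (P.eval x / x ^ P.natDegree) / Real.log x) atTop
      (𝓝 0) :=
    ((Real.continuousAt_log hP.ne').tendsto.comp hratio).div_atTop Real.tendsto_log_atTop
  have hsum := hzero.add_const (P.natDegree : ℝ)
  rw [zero_add] at hsum
  refine hsum.congr' ?_
  filter_upwards [hratio.eventually (lt_mem_nhds hP), eventually_gt_atTop 1] with x hx hx1
  have hpow : 0 < x ^ P.natDegree := by positivity
  have hlog : 0 < Real.log x := Real.log_pos hx1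
  have heval : P.eval x ≠ 0 := fun h => by simp [h] at hx
  rw [Real.log_div heval hpow.ne', Real.log_pow]
  field_simp
  ring

/-- A polynomial with positive leading coefficient is eventually positive. -/
theorem eventually_eval_pos (P : Polynomial ℝ) (hP : 0 < P.leadingCoeff) :
    ∀ᶠ x in atTop, 0 < P.eval x := by
  obtain ⟨u, hu, hPu⟩ := P.isEquivalent_atTop_lead.exists_eq_mul
  filter_upwards [hu.eventually (lt_mem_nhds one_pos), hPu, eventually_gt_atTop 0] with x hx hPx hx0
  rw [hPx]
  simp only [Pi.mul_apply]
  positivity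

theorem coeff_taylor_natDegree_sub_one {A : Type*} [CommRing A] (P : Polynomial A) (r : A)
    (hP : 1 ≤ P.natDegree) :
    (taylor r P).coeff (P.natDegree - 1) =
      P.coeff (P.natDegree - 1) + P.natDegree * P.leadingCoeff * r := by
  obtain ⟨n, hn⟩ := Nat.exists_eq_add_of_le' hP
  have hle : (hasseDeriv n P).natDegree ≤ 1 := by
    simpa [hn] using natDegree_hasseDeriv_le P n
  rw [leadingCoeff, hn, Nat.add_sub_cancel, taylor_coeff,
    eq_X_add_C_of_natDegree_le_one hle]
  simp [hasseDeriv_coeff, add_comm 1 n]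
  ring

/-- The backward difference `P(x) - P(x - c)` drops the degree by exactly one and scales the
leading coefficient by `c * P.natDegree`. -/
theorem natDegree_sub_taylor_neg (P : Polynomial ℝ) (hP : 1 ≤ P.natDegree)
    (hlc : 0 < P.leadingCoeff) {c : ℝ} (hc : 0 < c) :
    (P - taylor (-c) P).natDegree = P.natDegree - 1 ∧
      0 < (P - taylor (-c) P).leadingCoeff := by
  have hP0 : P ≠ 0 := leadingCoeff_ne_zero.mp hlc.ne'
  have hcoeff : 0 < (P - taylor (-c) P).coeff (P.natDegree - 1) := by
    rw [coeff_sub, coeff_taylor_natDegree_sub_one P _ hP]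
    have : 0 < (P.natDegree : ℝ) * P.leadingCoeff * c := by positivity
    linarith
  have hlt : (P - taylor (-c) P).natDegree < P.natDegree := by
    refine (natDegree_lt_natDegree_iff fun h => by simp [h] at hcoeff).mpr
      (degree_sub_lt_left (degree_taylor P _).symm hP0 (leadingCoeff_taylor _ _).symm)
  have hdeg : (P - taylor (-c) P).natDegree = P.natDegree - 1 :=
    le_antisymm (by omega) (le_natDegree_of_ne_zero hcoeff.ne')
  exact ⟨hdeg, by rwa [leadingCoeff, hdeg]⟩

theorem leadingCoeff_pos_of_eventually_nonneg (P : Polynomial ℝ) (hP : 1 ≤ P.natDegree)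
    (h : ∀ᶠ k : ℕ in atTop, 0 ≤ P.eval (k : ℝ)) : 0 < P.leadingCoeff := by
  by_contra! hneg
  have hbot := (tendsto_atBot_of_leadingCoeff_nonpos P (natDegree_pos_iff_degree_pos.mp hP)
    hneg).comp (tendsto_natCast_atTop_atTop (R := ℝ))
  obtain ⟨k, hk, hk'⟩ := (h.and (hbot.eventually_lt_atBot 0)).exists
  exact absurd hk (not_le.mpr hk')

end Polynomial

section PowSMul

variable {F : Type*} [Field F] {R : Type*} [Ring R] [Algebra F R] (J : Submodule F R)
  {M : Type*} [AddCommGroup M] [Module R M]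

theorem smul_mem_powSMulTop {k : ℕ} {a : R} (ha : a ∈ J ^ k) (m : M) :
    a • m ∈ powSMulTop J k M :=
  Submodule.subset_span ⟨a, ha, m, rfl⟩

theorem powSMulTop_succ_le (k : ℕ) : powSMulTop J (k + 1) M ≤ powSMulTop J k M := by
  refine Submodule.span_le.mpr ?_
  rintro _ ⟨a, ha, m, rfl⟩
  rw [pow_succ] at ha
  induction ha using Submodule.mul_induction_on' with
  | mem_mul_mem b hb c hc => rw [mul_smul]; exact smul_mem_powSMulTop J hb _
  | add y _ z _ hy hz => rw [add_smul]; exact add_mem hy hz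

theorem powSMulTop_antitone : Antitone fun k => powSMulTop J k M :=
  antitone_nat_of_succ_le (powSMulTop_succ_le J)

theorem map_mkQ_powSMulTop (N : Submodule R M) (k : ℕ) :
    (powSMulTop J k M).map N.mkQ = powSMulTop J k (M ⧸ N) := by
  rw [powSMulTop, Submodule.map_span, powSMulTop]
  congr 1
  ext y
  constructor
  · rintro ⟨_, ⟨a, ha, m, rfl⟩, rfl⟩
    exact ⟨a, ha, N.mkQ m, map_smul _ _ _⟩
  · rintro ⟨a, ha, m, rfl⟩
    obtain ⟨m, rfl⟩ := N.mkQ_surjective m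
    exact ⟨a • m, ⟨a, ha, m, rfl⟩, map_smul _ _ _⟩

/-- Multiplication by a central element, as a linear map. -/
def centralSMul (x : R) (hx : ∀ r : R, x * r = r * x) (M : Type*) [AddCommGroup M] [Module R M] :
    M →ₗ[R] M where
  toFun m := x • m
  map_add' := smul_add x
  map_smul' r m := by simp only [smul_smul, hx, RingHom.id_apply]

variable {x : R} (hx : ∀ r : R, x * r = r * x)

theorem elemSMulTop_eq_range : elemSMulTop x M = (centralSMul x hx M).range := by
  have : Set.range (fun m : M => x • m) = ((centralSMul x hx M).range : Set M) := by
    rw [LinearMap.coe_range]; rfl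
  rw [elemSMulTop, this, Submodule.span_eq]

theorem powSMulTop_le_comap_centralSMul (hxJ : x ∈ J) (k : ℕ) :
    powSMulTop J k M ≤ (powSMulTop J (k + 1) M).comap (centralSMul x hx M) := by
  refine Submodule.span_le.mpr ?_
  rintro _ ⟨a, ha, m, rfl⟩
  change x • a • m ∈ powSMulTop J (k + 1) M
  rw [smul_smul, hx]
  refine smul_mem_powSMulTop J ?_ m
  rw [pow_succ]
  exact Submodule.mul_mem_mul ha hxJ

theorem powSMulIn_elemSMulTop_le (k : ℕ) :
    powSMulIn J k (elemSMulTop x M) ≤ (powSMulTop J k M).map (centralSMul x hx M) := by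
  refine Submodule.span_le.mpr ?_
  rintro _ ⟨a, ha, n, hn, rfl⟩
  rw [elemSMulTop_eq_range hx] at hn
  obtain ⟨m, rfl⟩ := hn
  exact ⟨a • m, smul_mem_powSMulTop J ha m, map_smul _ _ _⟩

theorem comap_centralSMul_le_powSMulTop (hinj : Function.Injective (centralSMul x hx M)) {k l : ℕ}
    (hAR : powSMulTop J l M ⊓ elemSMulTop x M ≤ powSMulIn J k (elemSMulTop x M)) :
    (powSMulTop J l M).comap (centralSMul x hx M) ≤ powSMulTop J k M := by
  intro m hm
  obtain ⟨m', hm', h⟩ := powSMulIn_elemSMulTop_le J hx k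
    (hAR ⟨hm, by rw [elemSMulTop_eq_range hx]; exact ⟨m, rfl⟩⟩)
  rwa [← hinj h]

end PowSMul

section Finrank

variable {F : Type*} [Field F] {R : Type*} [Ring R] [Algebra F R]
  {M : Type*} [AddCommGroup M] [Module R M] [Module F M] [IsScalarTower F R M]

theorem finite_quotient_of_le {S T : Submodule R M} (h : S ≤ T) [Module.Finite F (M ⧸ S)] :
    Module.Finite F (M ⧸ T) :=
  Module.Finite.of_surjective ((Submodule.factor h).restrictScalars F)
    (Submodule.factor_surjective h)

theorem finrank_quotient_le_of_le {S T : Submodule R M} (h : S ≤ T) [Module.Finite F (M ⧸ S)] :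
    Module.finrank F (M ⧸ T) ≤ Module.finrank F (M ⧸ S) :=
  LinearMap.finrank_le_finrank_of_surjective (f := (Submodule.factor h).restrictScalars F)
    (Submodule.factor_surjective h)

/-- Additivity of dimension along `0 → M/f⁻¹(S) → M/S → M/(S + f(M)) → 0`. -/
theorem finrank_quotient_sup_range_add (f : M →ₗ[R] M) (S : Submodule R M)
    [Module.Finite F (M ⧸ S)] :
    Module.finrank F (M ⧸ (S ⊔ f.range)) + Module.finrank F (M ⧸ S.comap f) =
      Module.finrank F (M ⧸ S) := by
  let g : (M ⧸ S.comap f) →ₗ[R] M ⧸ S := Submodule.mapQ _ S f le_rfl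
  let q : (M ⧸ S) →ₗ[R] M ⧸ (S ⊔ f.range) := Submodule.factor le_sup_left
  have hg : Function.Injective g := by
    rw [← LinearMap.ker_eq_bot, Submodule.ker_mapQ, Submodule.mkQ_map_self]
  have hq : Function.Surjective q := Submodule.factor_surjective _
  have hker : LinearMap.ker (q.restrictScalars F) = LinearMap.range (g.restrictScalars F) := by
    ext y
    obtain ⟨m, rfl⟩ := S.mkQ_surjective y
    change (S ⊔ f.range).mkQ m = 0 ↔ S.mkQ m ∈ Set.range g
    rw [Submodule.mkQ_apply, Submodule.Quotient.mk_eq_zero]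
    constructor
    · intro hm
      obtain ⟨s, hs, _, ⟨n, rfl⟩, rfl⟩ := Submodule.mem_sup.mp hm
      refine ⟨(S.comap f).mkQ n, ?_⟩
      change S.mkQ (f n) = _
      simpa using hs
    · rintro ⟨y, hy⟩
      obtain ⟨n, rfl⟩ := (S.comap f).mkQ_surjective y
      have hmem : m - f n ∈ S := (Submodule.Quotient.eq S).mp hy.symm
      rw [← sub_add_cancel m (f n)]
      exact add_mem (Submodule.mem_sup_left hmem) (Submodule.mem_sup_right ⟨n, rfl⟩)
  have h := (q.restrictScalars F).finrank_range_add_finrank_ker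
  rwa [LinearMap.range_eq_top (f := q.restrictScalars F) |>.mpr hq, finrank_top, hker,
    LinearMap.finrank_range_of_inj (f := g.restrictScalars F) hg] at h

theorem finrank_quotient_powSMulTop_quotient (J : Submodule F R) (N : Submodule R M) (k : ℕ) :
    Module.finrank F ((M ⧸ N) ⧸ powSMulTop J k (M ⧸ N)) =
      Module.finrank F (M ⧸ (powSMulTop J k M ⊔ N)) := by
  rw [← map_mkQ_powSMulTop, sup_comm]
  exact ((Submodule.quotientQuotientEquivQuotientSup N (powSMulTop J k M)).restrictScalars
    F).finrank_eq

end Finrank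


/-- With `(R, J)` as in the Artin–Rees setting, `x ∈ J` central, and `M` a
finitely generated module with no `x`-torsion whose Hilbert function `dim_F (M/JᵏM)` is
eventually a polynomial `p` of degree `δ ≥ 1`, one has `dim_R (M/xM) = δ − 1`
(while `dim_R M = δ`). -/
theorem GKdim_quotient_central_elem {F : Type*} [Field F] {R : Type*} [Ring R] [Algebra F R]
    [IsNoetherianRing R]
    (J : Submodule F R)
    (hJl : ∀ (r a : R), a ∈ J → r * a ∈ J)
    (hJr : ∀ (r a : R), a ∈ J → a * r ∈ J)
    (hfin : FiniteDimensional F (R ⧸ J))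
    (hAR : ArtinReesProp.{v} J)
    (x : R) (hxJ : x ∈ J) (hxc : ∀ r : R, x * r = r * x)
    {M : Type v} [AddCommGroup M] [Module R M] [Module F M] [IsScalarTower F R M]
    [Module.Finite R M]
    (hxtf : ∀ m : M, x • m = 0 → m = 0)
    (p : Polynomial ℚ) (δ : ℕ) (hδ : 1 ≤ δ) (hdeg : p.natDegree = δ)
    (hp : ∀ᶠ k : ℕ in Filter.atTop,
      (Module.finrank F (M ⧸ powSMulTop J k M) : ℚ) = Polynomial.eval (k : ℚ) p) :
    GKdim J (M ⧸ elemSMulTop x M) = (δ : ℝ) - 1 ∧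
    Filter.limsup (fun k : ℕ =>
      Real.log (Module.finrank F (M ⧸ (powSMulTop J k M ⊔ elemSMulTop x M))) /
        Real.log k) Filter.atTop = (δ : ℝ) - 1 ∧
    GKdim J M = (δ : ℝ) := by
  have hinj : Function.Injective (centralSMul x hxc M) :=
    (injective_iff_map_eq_zero _).mpr hxtf
  set P : Polynomial ℝ := p.map (algebraMap ℚ ℝ)
  have hPdeg : P.natDegree = δ := by rw [Polynomial.natDegree_map, hdeg]
  have hP : ∀ᶠ k : ℕ in atTop,
      (Module.finrank F (M ⧸ powSMulTop J k M) : ℝ) = P.eval (k : ℝ) := by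
    filter_upwards [hp] with k hk
    have := congrArg (algebraMap ℚ ℝ) hk
    rwa [← Polynomial.eval_map_apply, map_natCast, map_natCast] at this
  have hlc : 0 < P.leadingCoeff := by
    refine P.leadingCoeff_pos_of_eventually_nonneg (hδ.trans_eq hPdeg.symm) ?_
    filter_upwards [hP] with k hk
    rw [← hk]
    positivity
  have hfinite : ∀ k, Module.Finite F (M ⧸ powSMulTop J k M) := by
    intro k
    have htop := (P.tendsto_atTop_of_leadingCoeff_nonneg (Polynomial.natDegree_pos_iff_degree_pos.mp
      (by omega)) hlc.le).comp (tendsto_natCast_atTop_atTop (R := ℝ))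
    obtain ⟨l, ⟨hl, hl0⟩, hkl⟩ :=
      ((hP.and (htop.eventually_gt_atTop 0)).and (eventually_ge_atTop k)).exists
    have : Module.Finite F (M ⧸ powSMulTop J l M) := by
      refine Module.finite_of_finrank_pos ?_
      have : (0 : ℝ) < Module.finrank F (M ⧸ powSMulTop J l M) := hl ▸ hl0
      exact_mod_cast this
    exact finite_quotient_of_le (powSMulTop_antitone J hkl)
  obtain ⟨c, hc⟩ := hAR M inferInstance (elemSMulTop x M)
  have hsum : ∀ k, Module.finrank F (M ⧸ (powSMulTop J k M ⊔ elemSMulTop x M)) +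
      Module.finrank F (M ⧸ (powSMulTop J k M).comap (centralSMul x hxc M)) =
        Module.finrank F (M ⧸ powSMulTop J k M) := by
    intro k
    rw [elemSMulTop_eq_range hxc]
    exact finrank_quotient_sup_range_add _ _
  have hdiff (n : ℕ) : ∀ᶠ k : ℕ in atTop, n ≤ k ∧
      (P - Polynomial.taylor (-(n : ℝ)) P).eval (k : ℝ) =
        (Module.finrank F (M ⧸ powSMulTop J k M) : ℝ) -
          Module.finrank F (M ⧸ powSMulTop J (k - n) M) := by
    filter_upwards [hP, (tendsto_sub_atTop_nat n).eventually hP, eventually_ge_atTop n]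
      with k hk hkn hn
    refine ⟨hn, ?_⟩
    rw [hk, hkn, Polynomial.eval_sub, Polynomial.taylor_eval, Nat.cast_sub hn, ← sub_eq_add_neg]
  have hlower : ∀ᶠ k : ℕ in atTop, (P - Polynomial.taylor (-((1 : ℕ) : ℝ)) P).eval (k : ℝ) ≤
      Module.finrank F (M ⧸ (powSMulTop J k M ⊔ elemSMulTop x M)) := by
    filter_upwards [hdiff 1] with k ⟨hk1, hk⟩
    obtain ⟨j, rfl⟩ := Nat.exists_eq_add_of_le' hk1
    rw [hk, Nat.add_sub_cancel, ← hsum (j + 1)]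
    have : (Module.finrank F (M ⧸ (powSMulTop J (j + 1) M).comap (centralSMul x hxc M)) : ℝ) ≤
        Module.finrank F (M ⧸ powSMulTop J j M) := by
      exact_mod_cast finrank_quotient_le_of_le (F := F)
        (powSMulTop_le_comap_centralSMul (M := M) J hxc hxJ j)
    push_cast
    linarith
  have hupper : ∀ᶠ k : ℕ in atTop,
      (Module.finrank F (M ⧸ (powSMulTop J k M ⊔ elemSMulTop x M)) : ℝ) ≤
        (P - Polynomial.taylor (-((c + 1 : ℕ) : ℝ)) P).eval (k : ℝ) := by
    filter_upwards [hdiff (c + 1)] with k ⟨hkc, hk⟩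
    obtain ⟨j, rfl⟩ := Nat.exists_eq_add_of_le' hkc
    rw [hk, Nat.add_sub_cancel, ← hsum (j + (c + 1))]
    have hle : (powSMulTop J (j + (c + 1)) M).comap (centralSMul x hxc M) ≤ powSMulTop J j M :=
      comap_centralSMul_le_powSMulTop J hxc hinj
        ((inf_le_inf_right _ (powSMulTop_antitone J (by omega))).trans (hc j))
    have : Module.Finite F
        (M ⧸ (powSMulTop J (j + (c + 1)) M).comap (centralSMul x hxc M)) :=
      finite_quotient_of_le (powSMulTop_le_comap_centralSMul (M := M) J hxc hxJ (j + c))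
    have : (Module.finrank F (M ⧸ powSMulTop J j M) : ℝ) ≤
        Module.finrank F (M ⧸ (powSMulTop J (j + (c + 1)) M).comap (centralSMul x hxc M)) := by
      exact_mod_cast finrank_quotient_le_of_le (F := F) hle
    push_cast
    linarith
  have hgrowth (n : ℕ) (hn : 0 < n) :
      (∀ᶠ k : ℕ in atTop, 0 < (P - Polynomial.taylor (-(n : ℝ)) P).eval (k : ℝ)) ∧
      Tendsto (fun k : ℕ => Real.log ((P - Polynomial.taylor (-(n : ℝ)) P).eval (k : ℝ)) /
        Real.log k) atTop (𝓝 ((δ : ℝ) - 1)) := by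
    obtain ⟨hD, hDlc⟩ := P.natDegree_sub_taylor_neg (by omega) hlc (c := n) (by exact_mod_cast hn)
    refine ⟨(tendsto_natCast_atTop_atTop (R := ℝ)).eventually
      (Polynomial.eventually_eval_pos _ hDlc), ?_⟩
    have := (Polynomial.tendsto_log_eval_div_log _ hDlc).comp
      (tendsto_natCast_atTop_atTop (R := ℝ))
    rwa [hD, hPdeg, Nat.cast_sub hδ, Nat.cast_one] at this
  obtain ⟨hpos, hlim⟩ := hgrowth 1 one_pos
  have hquot : limsup (fun k : ℕ =>
      Real.log (Module.finrank F (M ⧸ (powSMulTop J k M ⊔ elemSMulTop x M))) /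
        Real.log k) atTop = (δ : ℝ) - 1 := by
    refine (tendsto_of_tendsto_of_tendsto_of_le_of_le' hlim (hgrowth (c + 1) c.succ_pos).2
      ?_ ?_).limsup_eq
    · filter_upwards [hpos, hlower, eventually_ge_atTop 1] with k hk hkl hk1
      have := Real.log_natCast_nonneg k
      gcongr
    · filter_upwards [hpos, hlower, hupper] with k hk hkl hku
      have := Real.log_natCast_nonneg k
      have := hk.trans_le hkl
      gcongr
  refine ⟨?_, hquot, ?_⟩
  · simpa only [GKdim, finrank_quotient_powSMulTop_quotient] using hquot
  · have hM := (P.tendsto_log_eval_div_log hlc).comp (tendsto_natCast_atTop_atTop (R := ℝ))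
    rw [hPdeg] at hM
    refine (hM.congr' ?_).limsup_eq
    filter_upwards [hP] with k hk
    rw [hk]
    rfl
end

section
/- Let R be a commutative ring, G a group, H a subgroup of G, and ρ : G → GL₂(R) a group homomorphism. Suppose ψ₁, ψ₂ : H → Rˣ are functions such that for every h ∈ H the matrix ρ(h) is upper triangular with (1,1)-entry ψ₁(h) and (2,2)-entry ψ₂(h). Then for all σ, τ ∈ H and all η ∈ G: tr(ρ(στη)) − ψ₁(σ)·tr(ρ(τη)) − ψ₂(τ)·tr(ρ(ση)) + ψ₁(σ)ψ₂(τ)·tr(ρ(η)) = 0. -/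
/-- If `ρ : G → GL₂(R)` is upper triangular on a subgroup `H`, with diagonal
characters `ψ₁, ψ₂`, then the trace function `T = tr ∘ ρ` is `ψ₁`-ordinary:
`T(στη) − ψ₁(σ)T(τη) − ψ₂(τ)T(ση) + ψ₁(σ)ψ₂(τ)T(η) = 0` for `σ, τ ∈ H`, `η ∈ G`. -/
theorem trace_ordinary_of_upper_triangular
    {R : Type*} [CommRing R] {G : Type*} [Group G] (H : Subgroup G)
    (ρ : G →* Matrix.GeneralLinearGroup (Fin 2) R)
    (ψ₁ ψ₂ : H → Rˣ)
    (hup : ∀ h : H,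
      (ρ (h : G) : Matrix (Fin 2) (Fin 2) R) 1 0 = 0 ∧
      (ρ (h : G) : Matrix (Fin 2) (Fin 2) R) 0 0 = ψ₁ h ∧
      (ρ (h : G) : Matrix (Fin 2) (Fin 2) R) 1 1 = ψ₂ h) :
    ∀ (σ τ : H) (η : G),
      Matrix.trace ((ρ ((σ : G) * (τ : G) * η) : Matrix (Fin 2) (Fin 2) R)) -
          (ψ₁ σ : R) * Matrix.trace ((ρ ((τ : G) * η) : Matrix (Fin 2) (Fin 2) R)) -
          (ψ₂ τ : R) * Matrix.trace ((ρ ((σ : G) * η) : Matrix (Fin 2) (Fin 2) R)) +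
          (ψ₁ σ : R) * (ψ₂ τ : R) * Matrix.trace ((ρ η : Matrix (Fin 2) (Fin 2) R)) = 0 := by
  intro σ τ η
  obtain ⟨hσ₁₀, hσ₀₀, hσ₁₁⟩ := hup σ
  obtain ⟨hτ₁₀, hτ₀₀, hτ₁₁⟩ := hup τ
  simp only [map_mul, Units.val_mul, Matrix.trace_fin_two, Matrix.mul_apply, Fin.sum_univ_two,
    hσ₁₀, hσ₀₀, hσ₁₁, hτ₁₀, hτ₀₀, hτ₁₁]
  ring
end

section
/- Let K be a field, G a group, H a subgroup of G, and ρ : G → GL₂(K) a group homomorphism that is irreducible, in the sense that no one-dimensional K-subspace of K² is stable under ρ(g) for all g ∈ G. Suppose ψ₁, ψ₂ : H → Kˣ are functions with ψ₁ ≠ ψ₂, and b : H → K is a function such that for every h ∈ H the matrix ρ(h) has rows (ψ₂(h), b(h)) and (0, ψ₁(h)). Assume the trace function T = tr ∘ ρ satisfies T(στη) − ψ₁(σ)T(τη) − ψ₂(τ)T(ση) + ψ₁(σ)ψ₂(τ)T(η) = 0 for all σ, τ ∈ H and η ∈ G. Then there exists P ∈ GL₂(K) such that P ρ(h) P⁻¹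 is the diagonal matrix diag(ψ₁(h), ψ₂(h)) for every h ∈ H. -/
/-- Let `ρ : G → GL₂(K)` be irreducible (no stable line), upper triangular on a
subgroup `H` with diagonal characters `ψ₂, ψ₁` (in this order), `ψ₁ ≠ ψ₂`, and suppose the trace
function is `ψ₁`-ordinary.  Then `ρ|_H` can be conjugated into `diag (ψ₁, ψ₂)`. -/
theorem ordinary_implies_diagonalizable
    {K : Type*} [Field K] {G : Type*} [Group G] (H : Subgroup G)
    (ρ : G →* Matrix.GeneralLinearGroup (Fin 2) K)
    (hirr : ¬ ∃ v : Fin 2 → K, v ≠ 0 ∧ ∀ g : G,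
      ∃ c : K, ((ρ g : Matrix (Fin 2) (Fin 2) K)).mulVec v = c • v)
    (ψ₁ ψ₂ : H → Kˣ) (hψ : ψ₁ ≠ ψ₂) (b : H → K)
    (hshape : ∀ h : H,
      (ρ (h : G) : Matrix (Fin 2) (Fin 2) K) = !![(ψ₂ h : K), b h; 0, (ψ₁ h : K)])
    (hord : ∀ (σ τ : H) (η : G),
      Matrix.trace ((ρ ((σ : G) * (τ : G) * η) : Matrix (Fin 2) (Fin 2) K)) -
          (ψ₁ σ : K) * Matrix.trace ((ρ ((τ : G) * η) : Matrix (Fin 2) (Fin 2) K)) -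
          (ψ₂ τ : K) * Matrix.trace ((ρ ((σ : G) * η) : Matrix (Fin 2) (Fin 2) K)) +
          (ψ₁ σ : K) * (ψ₂ τ : K) * Matrix.trace ((ρ η : Matrix (Fin 2) (Fin 2) K)) = 0) :
    ∃ P : Matrix.GeneralLinearGroup (Fin 2) K, ∀ h : H,
      ((P * ρ (h : G) * P⁻¹ : Matrix.GeneralLinearGroup (Fin 2) K) : Matrix (Fin 2) (Fin 2) K) =
        Matrix.diagonal ![(ψ₁ h : K), (ψ₂ h : K)] := by
  obtain ⟨η, hη⟩ : ∃ η : G, (ρ η : Matrix (Fin 2) (Fin 2) K) 1 0 ≠ 0 := by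
    by_contra! hzero
    refine hirr ⟨![1, 0], by simp, fun g => ⟨(ρ g : Matrix (Fin 2) (Fin 2) K) 0 0, ?_⟩⟩
    ext i
    fin_cases i <;> simp [Matrix.mulVec, dotProduct, hzero g]
  have hcross (σ τ : H) :
      ((ψ₂ σ : K) - ψ₁ σ) * b τ = b σ * ((ψ₂ τ : K) - ψ₁ τ) := by
    have h := hord σ τ η
    simp only [map_mul, Units.val_mul, hshape, Matrix.trace_fin_two, Matrix.mul_apply,
      Fin.sum_univ_two, Matrix.of_apply, Matrix.cons_val', Matrix.cons_val_zero,
      Matrix.cons_val_one, Matrix.cons_val_fin_one] at h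
    refine mul_right_cancel₀ hη ?_
    linear_combination h
  obtain ⟨h₀, hh₀⟩ := Function.ne_iff.mp hψ
  have hd : (ψ₂ h₀ : K) - ψ₁ h₀ ≠ 0 :=
    sub_ne_zero.mpr fun h => hh₀ (Units.ext h.symm)
  obtain ⟨x, hx⟩ : ∃ x : K, ∀ h : H, b h = x * ((ψ₂ h : K) - ψ₁ h) := by
    refine ⟨b h₀ / ((ψ₂ h₀ : K) - ψ₁ h₀), fun h => ?_⟩
    rw [div_mul_eq_mul_div, eq_div_iff hd, mul_comm]
    exact hcross h₀ h
  refine ⟨⟨!![0, 1; 1, x], !![-x, 1; 1, 0], ?_, ?_⟩, fun h => ?_⟩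
  · simp [Matrix.one_fin_two]
  · simp [Matrix.one_fin_two]
  · rw [Units.val_mul, Units.val_mul, Units.inv_mk, hshape, hx]
    ext i j
    fin_cases i <;> fin_cases j <;> simp
    ring
end
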